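/- arXiv:1103.1232 — 2 statements merged into one kernel-verified Lean document; each statement's English description precedes it below -/
import Mathlib

section
/- The word problem of the Baumslag group G_(1,2) is decidable: there exists a computable function f : List (Fin 2 × Bool) → Bool such that for every word w, f(w) = true if and only if the product over w of the generators (pairing (i, true) with the i-th generator and (i, false) with its inverse) equals the identity element of G_(1,2). -/
/-- The single relator `(b a b⁻¹) a (b a b⁻¹)⁻¹ a⁻²` of the Baumslag group G_(1,2),
with `a` the generator of index `0` and `b` the generator of index `1`. -/
def baumRels : Set (FreeGroup (Fin 2)) :=
  {(FreeGroup.of 1 * FreeGroup.of 0 * (FreeGroup.of 1)⁻¹) * FreeGroup.of 0 *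
      (FreeGroup.of 1 * FreeGroup.of 0 * (FreeGroup.of 1)⁻¹)⁻¹ *
      (FreeGroup.of 0 * FreeGroup.of 0)⁻¹}

/-- The Baumslag group G_(1,2) = ⟨a, b ∣ (b a b⁻¹) a (b a b⁻¹)⁻¹ = a²⟩. -/
abbrev Baumslag : Type := PresentedGroup baumRels

/-- The generator `a` of the Baumslag group. -/
def bgA : Baumslag := PresentedGroup.of 0

/-- The generator `b` of the Baumslag group. -/
def bgB : Baumslag := PresentedGroup.of 1

/-- Evaluation of a word over the generators of the Baumslag group and their inverses:
the letter `(i, true)` stands for the `i`-th generator and `(i, false)` for its inverse. -/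
def baumEvalWord (w : List (Fin 2 × Bool)) : Baumslag :=
  (w.map fun p => if p.2 then (PresentedGroup.of p.1 : Baumslag) else (PresentedGroup.of p.1)⁻¹).prod

namespace BaumWP

/-- Codes for elements of `BS(1,2)`: `(p,q,k,r,s)` stands for `t^{-k} a^{p-q} t^{k+r-s}`. -/
abbrev Code : Type := ℕ × ℕ × ℕ × ℕ × ℕ

def cmul (x y : Code) : Code :=
  (x.1 * 2 ^ (x.2.2.2.2 + y.2.2.1) + y.1 * 2 ^ (x.2.2.2.1 + x.2.2.1),
   x.2.1 * 2 ^ (x.2.2.2.2 + y.2.2.1) + y.2.1 * 2 ^ (x.2.2.2.1 + x.2.2.1),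
   x.2.2.1 + x.2.2.2.2 + y.2.2.1,
   x.2.2.2.1 + y.2.2.2.1,
   x.2.2.2.2 + y.2.2.2.2)

def cone : Code := (0, 0, 0, 0, 0)

/-- membership test in the associated subgroup (`⟨a⟩` for `true`, `⟨t⟩` for `false`) -/
def memb (e : Bool) (x : Code) : Bool :=
  if e = true then
    decide (x.2.2.2.1 = x.2.2.2.2) && decide (x.1 % 2 ^ x.2.2.1 = x.2.1 % 2 ^ x.2.2.1)
  else decide (x.1 = x.2.1)

/-- the isomorphism between associated subgroups on codes -/
def conv (e : Bool) (x : Code) : Code :=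
  if e = true then (0, 0, 0, (x.1 - x.2.1) / 2 ^ x.2.2.1, (x.2.1 - x.1) / 2 ^ x.2.2.1)
  else (x.2.2.2.1, x.2.2.2.2, 0, 0, 0)

abbrev St : Type := Code × List (Bool × Code)

def pushB (e : Bool) (st : St) : St :=
  List.casesOn st.2 (cone, [(e, st.1)]) (fun h l =>
    if (h.1 == !e && memb e st.1) = true then (cmul (conv e st.1) h.2, l)
    else (cone, (e, st.1) :: h :: l))

def pushA (e : Bool) (st : St) : St :=
  (cmul (if e = true then (1, 0, 0, 0, 0) else (0, 1, 0, 0, 0)) st.1, st.2)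

def step (c : Fin 2 × Bool) (st : St) : St :=
  if c.1 = 0 then pushA c.2 st else pushB c.2 st

def run (w : List (Fin 2 × Bool)) : St := w.foldr step (cone, [])

def final (st : St) : Bool :=
  decide (st.2.length = 0) && (decide (st.1.1 = st.1.2.1) && decide (st.1.2.2.2.1 = st.1.2.2.2.2))

section prim
open Primrec

theorem pow_prim : Primrec (fun n : ℕ => 2 ^ n) := by
  have h : Primrec (fun n : ℕ => (Nat.rec 1 (fun _ x => x * 2) n : ℕ)) :=
    Primrec.nat_rec' Primrec.id (Primrec.const 1)
      (Primrec.nat_mul.comp (Primrec.snd.comp Primrec.snd) (Primrec.const 2)).to₂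
  refine h.of_eq fun n => ?_
  induction n with
  | zero => rfl
  | succ n ih => simp [ih, pow_succ]

theorem p1 : Primrec (fun x : Code => x.1) := Primrec.fst
theorem p2 : Primrec (fun x : Code => x.2.1) := fst.comp snd
theorem p3 : Primrec (fun x : Code => x.2.2.1) := fst.comp (snd.comp snd)
theorem p4 : Primrec (fun x : Code => x.2.2.2.1) := fst.comp (snd.comp (snd.comp snd))
theorem p5 : Primrec (fun x : Code => x.2.2.2.2) := snd.comp (snd.comp (snd.comp snd))

theorem cmul_prim : Primrec₂ cmul := by
  have a : Primrec (fun z : Code × Code => 2 ^ (z.1.2.2.2.2 + z.2.2.2.1)) :=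
    pow_prim.comp (nat_add.comp (p5.comp fst) (p3.comp snd))
  have b : Primrec (fun z : Code × Code => 2 ^ (z.1.2.2.2.1 + z.1.2.2.1)) :=
    pow_prim.comp (nat_add.comp (p4.comp fst) (p3.comp fst))
  exact Primrec.pair
    (nat_add.comp (nat_mul.comp (p1.comp fst) a) (nat_mul.comp (p1.comp snd) b))
    (Primrec.pair
      (nat_add.comp (nat_mul.comp (p2.comp fst) a) (nat_mul.comp (p2.comp snd) b))
      (Primrec.pair
        (nat_add.comp (nat_add.comp (p3.comp fst) (p5.comp fst)) (p3.comp snd))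
        (Primrec.pair (nat_add.comp (p4.comp fst) (p4.comp snd))
          (nat_add.comp (p5.comp fst) (p5.comp snd)))))

theorem memb_prim : Primrec₂ memb := by
  have a : Primrec (fun z : Bool × Code => 2 ^ z.2.2.2.1) := pow_prim.comp (p3.comp snd)
  refine Primrec.ite (Primrec.eq.comp fst (Primrec.const true)) ?_ ?_
  · exact Primrec.and.comp (Primrec.eq.decide.comp (p4.comp snd) (p5.comp snd))
      (Primrec.eq.decide.comp (nat_mod.comp (p1.comp snd) a) (nat_mod.comp (p2.comp snd) a))
  · exact Primrec.eq.decide.comp (p1.comp snd) (p2.comp snd)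

theorem conv_prim : Primrec₂ conv := by
  have a : Primrec (fun z : Bool × Code => 2 ^ z.2.2.2.1) := pow_prim.comp (p3.comp snd)
  have c0 : Primrec (fun _ : Bool × Code => 0) := Primrec.const 0
  refine Primrec.ite (Primrec.eq.comp fst (Primrec.const true)) ?_ ?_
  · exact c0.pair (c0.pair (c0.pair (Primrec.pair
      (nat_div.comp (nat_sub.comp (p1.comp snd) (p2.comp snd)) a)
      (nat_div.comp (nat_sub.comp (p2.comp snd) (p1.comp snd)) a))))
  · exact (p4.comp snd).pair ((p5.comp snd).pair (Primrec.const (0, 0, 0)))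

theorem pushB_prim : Primrec₂ pushB := by
  refine Primrec.list_casesOn (f := fun z : Bool × St => z.2.2)
    (g := fun z => (cone, [(z.1, z.2.1)]))
    (h := fun z hl => if (hl.1.1 == !z.1 && memb z.1 z.2.1) = true then
      (cmul (conv z.1 z.2.1) hl.1.2, hl.2)
    else (cone, (z.1, z.2.1) :: hl.1 :: hl.2)) (snd.comp snd) ?_ ?_
  · exact (Primrec.const cone).pair
      (list_cons.comp (fst.pair (fst.comp snd)) (Primrec.const []))
  · have e : Primrec (fun z : (Bool × St) × ((Bool × Code) × List (Bool × Code)) => z.1.1) :=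
      fst.comp fst
    have g : Primrec (fun z : (Bool × St) × ((Bool × Code) × List (Bool × Code)) => z.1.2.1) :=
      fst.comp (snd.comp fst)
    refine Primrec.ite (Primrec.eq.comp (Primrec.and.comp
      (Primrec.beq.comp (fst.comp (fst.comp snd)) (Primrec.not.comp e))
      (memb_prim.comp e g)) (Primrec.const true)) ?_ ?_
    · exact (cmul_prim.comp (conv_prim.comp e g) (snd.comp (fst.comp snd))).pair (snd.comp snd)
    · exact (Primrec.const cone).pair (list_cons.comp (e.pair g)
        (list_cons.comp (fst.comp snd) (snd.comp snd)))

theorem pushA_prim : Primrec₂ pushA :=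
  (cmul_prim.comp (Primrec.ite (Primrec.eq.comp fst (Primrec.const true))
    (Primrec.const _) (Primrec.const _)) (fst.comp snd)).pair (snd.comp snd)

theorem step_prim : Primrec₂ step :=
  Primrec.ite (Primrec.eq.comp (fst.comp fst) (Primrec.const 0))
    (pushA_prim.comp (snd.comp fst) snd) (pushB_prim.comp (snd.comp fst) snd)

theorem run_prim : Primrec run :=
  Primrec.list_foldr (f := fun w : List (Fin 2 × Bool) => w) (g := fun _ => (cone, []))
    (h := fun _ z => step z.1 z.2) Primrec.id (Primrec.const _)
    (step_prim.comp (fst.comp snd) (snd.comp snd)).to₂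

theorem final_prim : Primrec final :=
  Primrec.and.comp (Primrec.eq.decide.comp (Primrec.list_length.comp snd) (Primrec.const 0))
    (Primrec.and.comp (Primrec.eq.decide.comp (p1.comp fst) (p2.comp fst))
      (Primrec.eq.decide.comp (p4.comp fst) (p5.comp fst)))

end prim

section ev
variable {K : Type*} [Group K]

def ev (a t : K) (x : Code) : K :=
  t ^ (-(x.2.2.1 : ℤ)) * a ^ ((x.1 : ℤ) - x.2.1) * t ^ ((x.2.2.1 : ℤ) + x.2.2.2.1 - x.2.2.2.2)

variable {a t : K}

theorem conj_zpow' (h : t * a * t⁻¹ = a * a) (j : ℕ) (m : ℤ) :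
    t ^ (j : ℤ) * a ^ m * t ^ (-(j : ℤ)) = a ^ (m * 2 ^ j) := by
  induction j generalizing m with
  | zero => simp
  | succ j ih =>
    have h1 : t * a ^ m * t⁻¹ = a ^ (m * 2) := by
      rw [← conj_zpow, h, mul_comm, zpow_mul, zpow_two]
    calc _ = t ^ (j : ℤ) * (t * a ^ m * t⁻¹) * t ^ (-(j : ℤ)) := by
            push_cast; rw [neg_add, zpow_add, add_comm, zpow_add]; group
      _ = _ := by rw [h1, ih]; congr 1; ring

theorem conj_zpow'' (h : t * a * t⁻¹ = a * a) (j : ℕ) (m : ℤ) :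
    t ^ (-(j : ℤ)) * a ^ (m * 2 ^ j) * t ^ (j : ℤ) = a ^ m := by
  rw [← conj_zpow' h]; group

theorem ev_mul (h : t * a * t⁻¹ = a * a) (x y : Code) :
    ev a t (cmul x y) = ev a t x * ev a t y := by
  obtain ⟨p, q, k, r, s⟩ := x
  obtain ⟨p', q', k', r', s'⟩ := y
  simp only [ev, cmul]
  have e : ((p * 2 ^ (s + k') + p' * 2 ^ (r + k) : ℕ) : ℤ) -
      ((q * 2 ^ (s + k') + q' * 2 ^ (r + k) : ℕ) : ℤ) =
      ((p : ℤ) - q) * 2 ^ (s + k') + ((p' : ℤ) - q') * 2 ^ (r + k) := by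
    push_cast; ring
  rw [e, zpow_add, ← conj_zpow' h, ← conj_zpow' h]
  push_cast
  generalize (p : ℤ) - q = m
  generalize (p' : ℤ) - q' = m'
  generalize a ^ m = A
  generalize a ^ m' = A'
  group

theorem ev_memb_true (h : t * a * t⁻¹ = a * a) (x : Code) (hx : memb true x = true) :
    ∃ m : ℤ, ev a t x = a ^ m ∧ ev a t (conv true x) = t ^ m := by
  obtain ⟨p, q, k, r, s⟩ := x
  simp only [memb, if_true, Bool.and_eq_true, decide_eq_true_eq] at hx
  obtain ⟨rfl, hx⟩ := hx
  have hd : ((2 ^ k : ℕ) : ℤ) ∣ (q : ℤ) - p := Nat.modEq_iff_dvd.1 hx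
  obtain ⟨c, hc⟩ := hd
  refine ⟨-c, ?_, ?_⟩
  · simp only [ev]
    have e1 : (p : ℤ) - q = -c * 2 ^ k := by push_cast at hc; linarith
    have e2 : (k : ℤ) + r - r = k := by ring
    rw [e1, e2, conj_zpow'' h k]
  · have hpos : 0 < 2 ^ k := by positivity
    simp only [ev, conv, if_true]
    have : (((p - q) / 2 ^ k : ℕ) : ℤ) - ((q - p) / 2 ^ k : ℕ) = -c := by
      rcases le_total p q with hpq | hpq
      · obtain ⟨d, rfl⟩ := Nat.exists_eq_add_of_le hpq
        have : (d : ℤ) = (2 ^ k : ℕ) * c := by push_cast at hc ⊢; linarith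
        rw [Nat.sub_eq_zero_of_le hpq, Nat.add_sub_cancel_left, Nat.zero_div, Int.natCast_div, this,
          Int.mul_ediv_cancel_left _ (by positivity)]
        simp
      · obtain ⟨d, rfl⟩ := Nat.exists_eq_add_of_le hpq
        have : (d : ℤ) = (2 ^ k : ℕ) * (-c) := by push_cast at hc ⊢; linarith
        rw [Nat.sub_eq_zero_of_le hpq, Nat.add_sub_cancel_left, Nat.zero_div, Int.natCast_div, this,
          Int.mul_ediv_cancel_left _ (by positivity)]
        simp
    simp [← this, sub_eq_add_neg]

theorem ev_memb_false (x : Code) (hx : memb false x = true) :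
    ∃ m : ℤ, ev a t x = t ^ m ∧ ev a t (conv false x) = a ^ m := by
  obtain ⟨p, q, k, r, s⟩ := x
  simp [memb] at hx
  subst hx
  refine ⟨(r : ℤ) - s, ?_, ?_⟩
  · simp only [ev, sub_self, zpow_zero, mul_one, ← zpow_add]
    congr 1; ring
  · simp [ev, conv]

end ev

/-! ### evaluation of states -/

section st
variable {K : Type*} [Group K]

def sg (e : Bool) : ℤˣ := if e = true then 1 else -1

def evSt (a t b : K) (st : St) : K :=
  ev a t st.1 * (st.2.map fun z => b ^ (sg z.1 : ℤ) * ev a t z.2).prod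

variable {a t b : K}

theorem evSt_pushB (hb : b * a * b⁻¹ = t) (h : t * a * t⁻¹ = a * a) (e : Bool) (st : St) :
    evSt a t b (pushB e st) = b ^ (sg e : ℤ) * evSt a t b st := by
  obtain ⟨g, l⟩ := st
  have h1 : ev a t cone = 1 := by simp [ev, cone]
  rcases l with _ | ⟨⟨e', g'⟩, l⟩
  · simp [pushB, evSt, h1]
  · simp only [pushB]
    split_ifs with hc
    · simp only [Bool.and_eq_true, beq_iff_eq] at hc
      obtain ⟨rfl, hm⟩ := hc
      simp only [evSt, ev_mul h, List.map_cons, List.prod_cons, ← mul_assoc]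
      congr 2
      have hz : ∀ m : ℤ, b * a ^ m * b⁻¹ = t ^ m := fun m => by rw [← hb, conj_zpow]
      cases e
      · obtain ⟨m, h2, h3⟩ := ev_memb_false (a := a) (t := t) g hm
        rw [h2, h3, ← hz]; simp [sg, mul_assoc]
      · obtain ⟨m, h2, h3⟩ := ev_memb_true h g hm
        rw [h2, h3, ← hz]; simp [sg]
    · simp [evSt, h1, mul_assoc]

theorem evSt_pushA (h : t * a * t⁻¹ = a * a) (e : Bool) (st : St) :
    evSt a t b (pushA e st) = a ^ (sg e : ℤ) * evSt a t b st := by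
  simp only [pushA, evSt, ev_mul h, mul_assoc]
  congr 1
  cases e <;> simp [ev, sg]

theorem evSt_final (st : St) (hf : final st = true) : evSt a t b st = 1 := by
  obtain ⟨⟨p, q, k, r, s⟩, l⟩ := st
  simp [final] at hf
  obtain ⟨rfl, rfl, rfl⟩ := hf
  simp [evSt, ev]

end st

def bgT : Baumslag := bgB * bgA * bgB⁻¹

theorem bg_rel : bgT * bgA * bgT⁻¹ = bgA * bgA := by
  have h : (PresentedGroup.mk baumRels) ((FreeGroup.of 1 * FreeGroup.of 0 * (FreeGroup.of 1)⁻¹) *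
      FreeGroup.of 0 * (FreeGroup.of 1 * FreeGroup.of 0 * (FreeGroup.of 1)⁻¹)⁻¹ *
      (FreeGroup.of 0 * FreeGroup.of 0)⁻¹) = 1 :=
    PresentedGroup.one_of_mem rfl
  rw [map_mul, map_inv, mul_inv_eq_one] at h
  simpa [bgT, bgA, bgB, PresentedGroup.of] using h

theorem evSt_run (w : List (Fin 2 × Bool)) : evSt bgA bgT bgB (run w) = baumEvalWord w := by
  induction w with
  | nil => simp [run, evSt, ev, cone, baumEvalWord]
  | cons c w ih =>
    obtain ⟨i, e⟩ := c
    have h1 : baumEvalWord ((i, e) :: w) = (if e = true then (PresentedGroup.of i : Baumslag)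
      else (PresentedGroup.of i)⁻¹) * baumEvalWord w := by simp [baumEvalWord]
    rw [h1, ← ih]
    change evSt _ _ _ (step (i, e) (run w)) = _
    fin_cases i
    · simp only [step]
      rw [if_pos (by rfl), evSt_pushA bg_rel]
      cases e <;> simp [sg, bgA]
    · simp only [step]
      rw [if_neg (by simp), evSt_pushB (t := bgT) rfl bg_rel]
      cases e <;> simp [sg, bgB]

/-! ### the concrete HNN extension -/

abbrev H : Type := Equiv.Perm ℚ

def hA : H := Equiv.addRight 1
def hT : H := Equiv.mulLeft₀ 2 two_ne_zero

theorem hA_zpow (m : ℤ) (y : ℚ) : (hA ^ m) y = y + m := by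
  simp [hA]

theorem hT_nat (m : ℕ) (y : ℚ) : (hT ^ m) y = 2 ^ m * y := by
  induction m generalizing y with
  | zero => simp
  | succ m ih => rw [pow_succ, Equiv.Perm.mul_apply, ih]; simp [hT]; ring

theorem hT_zpow (m : ℤ) (y : ℚ) : (hT ^ m) y = 2 ^ m * y := by
  rcases Int.eq_nat_or_neg m with ⟨n, rfl | rfl⟩
  · simp [hT_nat]
  · rw [zpow_neg, Equiv.Perm.inv_eq_iff_eq, zpow_natCast, hT_nat]; simp

theorem h_rel : hT * hA * hT⁻¹ = hA * hA := by
  rw [mul_inv_eq_iff_eq_mul]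
  ext y
  simp [hA, hT]; ring

theorem hA_inj : Function.Injective (zpowersHom H hA) := by
  intro m n h
  have := congrArg (fun f : H => f 0) h
  simpa [zpowersHom_apply, hA_zpow] using this

theorem hT_inj : Function.Injective (zpowersHom H hT) := by
  intro m n h
  have := congrArg (fun f : H => f 1) h
  simp only [zpowersHom_apply, hT_zpow, mul_one] at this
  exact zpow_right_injective₀ (by norm_num : (0 : ℚ) < 2) (by norm_num) this

noncomputable def phi : (zpowersHom H hA).range ≃* (zpowersHom H hT).range :=
  (MonoidHom.ofInjective hA_inj).symm.trans (MonoidHom.ofInjective hT_inj)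

abbrev X : Type := HNNExtension H _ _ phi

theorem X_rel : (HNNExtension.t : X) * HNNExtension.of hA * HNNExtension.t⁻¹ =
    HNNExtension.of hT := by
  have h := HNNExtension.equiv_eq_conj (φ := phi) ⟨hA, Multiplicative.ofAdd 1, by simp⟩
  rw [← h]
  congr 1
  have : (⟨hA, Multiplicative.ofAdd 1, by simp⟩ : (zpowersHom H hA).range) =
      MonoidHom.ofInjective hA_inj (Multiplicative.ofAdd 1) := by
    ext1; simp [MonoidHom.ofInjective_apply]
  rw [this]
  simp [phi, MonoidHom.ofInjective_apply]

noncomputable def psi : Baumslag →* X :=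
  PresentedGroup.toGroup (f := ![HNNExtension.of hA, HNNExtension.t]) (by
    intro r hr
    rw [Set.mem_singleton_iff.1 hr]
    simp only [map_mul, map_inv, FreeGroup.lift_apply_of]
    simp only [Matrix.cons_val_zero, Matrix.cons_val_one]
    rw [X_rel, mul_inv_eq_one, ← map_mul, ← map_inv, ← map_mul, h_rel, map_mul])

theorem psi_A : psi bgA = HNNExtension.of hA := by simp [psi, bgA]
theorem psi_B : psi bgB = HNNExtension.t := by simp [psi, bgB]
theorem psi_T : psi bgT = HNNExtension.of hT := by
  rw [bgT, map_mul, map_mul, map_inv, psi_A, psi_B, X_rel]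

theorem psi_ev (x : Code) : psi (ev bgA bgT x) = HNNExtension.of (ev hA hT x) := by
  simp [ev, psi_A, psi_T]

theorem ev_apply (x : Code) (y : ℚ) : ev hA hT x y =
    2 ^ (-(x.2.2.1 : ℤ)) * (2 ^ ((x.2.2.1 : ℤ) + x.2.2.2.1 - x.2.2.2.2) * y + (x.1 - x.2.1)) := by
  simp only [ev, Equiv.Perm.mul_apply, hA_zpow, hT_zpow]
  push_cast; rfl

theorem two_zpow_eq_one {m : ℤ} (h : (2 : ℚ) ^ m = 1) : m = 0 :=
  zpow_right_injective₀ (by norm_num : (0 : ℚ) < 2) (by norm_num) (by simpa using h)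

theorem memb_of_mem (e : Bool) (x : Code)
    (hx : ev hA hT x ∈ HNNExtension.toSubgroup (zpowersHom H hA).range (zpowersHom H hT).range
      (sg e)) : memb e x = true := by
  obtain ⟨p, q, k, r, s⟩ := x
  have two : (2 : ℚ) ≠ 0 := by norm_num
  have tk : (2 : ℚ) ^ k ≠ 0 := by positivity
  cases e
  · change _ ∈ (zpowersHom H hT).range at hx
    obtain ⟨m, hm⟩ := hx
    have h0 := congrArg (fun f : H => f 0) hm
    simp only [zpowersHom_apply, hT_zpow, ev_apply] at h0
    simp [sub_eq_zero] at h0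
    simpa [memb] using h0
  · change _ ∈ (zpowersHom H hA).range at hx
    obtain ⟨m, hm⟩ := hx
    have h0 := congrArg (fun f : H => f 0) hm
    have h1 := congrArg (fun f : H => f 1) hm
    simp only [zpowersHom_apply, hA_zpow, ev_apply] at h0 h1
    have h2 : (2 : ℚ) ^ (-(k : ℤ)) * 2 ^ ((k : ℤ) + r - s) = 1 := by linarith
    rw [← zpow_add₀ two] at h2
    have h3 := two_zpow_eq_one h2
    rw [mul_zero, zero_add, zero_add, zpow_neg, zpow_natCast, eq_inv_mul_iff_mul_eq₀ tk] at h0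
    simp only [memb, if_true, Bool.and_eq_true, decide_eq_true_eq]
    refine ⟨by omega, ?_⟩
    apply Nat.modEq_iff_dvd.2
    refine ⟨-m.toAdd, ?_⟩
    have : (2 : ℤ) ^ k * m.toAdd = p - q := by exact_mod_cast h0
    push_cast; linarith

/-- The chain condition for a state. -/
def Good (st : St) : Prop :=
  (st.2.map fun z => (sg z.1, ev hA hT z.2)).IsChain fun x y =>
    x.2 ∈ HNNExtension.toSubgroup (zpowersHom H hA).range (zpowersHom H hT).range x.1 → x.1 = y.1

theorem good_pushB (e : Bool) (st : St) (h : Good st) : Good (pushB e st) := by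
  obtain ⟨g, l⟩ := st
  rcases l with _ | ⟨⟨e', g'⟩, l⟩
  · simp [pushB, Good]
  · simp only [pushB]
    split_ifs with hc
    · exact List.IsChain.tail h
    · simp only [Good, List.map_cons, List.isChain_cons_cons] at h ⊢
      refine ⟨fun hm => ?_, h⟩
      have := memb_of_mem e g hm
      simp only [this, Bool.and_true, beq_iff_eq] at hc
      congr 1
      revert hc
      cases e <;> cases e' <;> simp

theorem good_run (w : List (Fin 2 × Bool)) : Good (run w) := by
  induction w with
  | nil => simp [run, Good]
  | cons c w ih =>
    change Good (step c (run w))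
    unfold step
    split_ifs
    · exact ih
    · exact good_pushB _ _ ih

theorem final_of_good (st : St) (hg : Good st) (h : evSt bgA bgT bgB st = 1) :
    final st = true := by
  have h' := congrArg psi h
  let W : HNNExtension.NormalWord.ReducedWord H (zpowersHom H hA).range (zpowersHom H hT).range :=
    ⟨ev hA hT st.1, st.2.map fun z : Bool × Code => (sg z.1, ev hA hT z.2), hg⟩
  have hW : W.prod phi = 1 := by
    rw [← map_one psi, ← h', evSt, map_mul, psi_ev, map_list_prod]
    simp only [W, HNNExtension.NormalWord.ReducedWord.prod, List.map_map]
    congr 3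
    funext z
    simp [psi_ev, psi_B]
  have hn : W.toList = [] :=
    HNNExtension.ReducedWord.toList_eq_nil_of_mem_of_range phi W (by rw [hW]; exact one_mem _)
  have hl : st.2 = [] := by simpa [W] using hn
  have h1 : ev hA hT st.1 = 1 := by
    apply HNNExtension.of_injective (φ := phi)
    rw [map_one, ← hW]
    simp [HNNExtension.NormalWord.ReducedWord.prod, W, hl]
  obtain ⟨⟨p, q, k, r, s⟩, l⟩ := st
  simp only at hl h1
  subst hl
  have tk : (2 : ℚ) ^ k ≠ 0 := by positivity
  have h2 := congrArg (fun f : H => f 0) h1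
  have h3 := congrArg (fun f : H => f 1) h1
  simp only [ev_apply, Equiv.Perm.one_apply] at h2 h3
  have h4 : (2 : ℚ) ^ (-(k : ℤ)) * 2 ^ ((k : ℤ) + r - s) = 1 := by linarith
  rw [← zpow_add₀ (by norm_num)] at h4
  have h5 := two_zpow_eq_one h4
  simp [sub_eq_zero] at h2
  simp only [final, List.length_nil, decide_true, Bool.true_and, Bool.and_eq_true, decide_eq_true_eq]
  exact ⟨h2, by omega⟩

end BaumWP

/-- The word problem of the Baumslag group G_(1,2) is decidable: there is a
computable function deciding whether a word over the generators and their inverses represents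
the identity. -/
theorem baumslag_word_problem_decidable :
    ∃ f : List (Fin 2 × Bool) → Bool, Computable f ∧
      ∀ w : List (Fin 2 × Bool), f w = true ↔ baumEvalWord w = 1 := by
  refine ⟨fun w => BaumWP.final (BaumWP.run w),
    (BaumWP.final_prim.comp BaumWP.run_prim).to_comp, fun w => ?_⟩
  rw [← BaumWP.evSt_run]
  exact ⟨BaumWP.evSt_final _, BaumWP.final_of_good _ (BaumWP.good_run w)⟩
end

section
/- The word problem of the Higman group H_4 is decidable: there exists a computable function f : List (Fin 4 × Bool) → Bool such that for every word w, f(w) = true if and only if the product over w of the generators (pairing (i, true) with the generator a_{i+1} and (i, false) with its inverse) equals the identity element of H_4. -/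
/-- The relators `a_p a_{p−1} a_p⁻¹ a_{p−1}⁻²` (for `p ∈ ℤ/qℤ`) of the Higman group. -/
def higmanRels (q : ℕ) : Set (FreeGroup (ZMod q)) :=
  Set.range fun p : ZMod q =>
    FreeGroup.of p * FreeGroup.of (p - 1) * (FreeGroup.of p)⁻¹ *
      (FreeGroup.of (p - 1) * FreeGroup.of (p - 1))⁻¹

/-- The Higman group `H_q`, generated by `a_p` for `p ∈ ℤ/qℤ` subject to the relations
`a_p a_{p−1} a_p⁻¹ = a_{p−1}²`. -/
abbrev Higman (q : ℕ) : Type := PresentedGroup (higmanRels q)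

/-- The generator `a_p` of the Higman group `H_q`. -/
def hgen (q : ℕ) (p : ZMod q) : Higman q := PresentedGroup.of p

/-- Evaluation of a word over the generators of the Higman group H₄ and their inverses:
the letter `(i, true)` stands for the generator `a_{i+1}` and `(i, false)` for its inverse. -/
def higmanEvalWord (w : List (Fin 4 × Bool)) : Higman 4 :=
  (w.map fun p =>
    if p.2 then hgen 4 (((p.1 : ℕ) : ZMod 4) + 1) else (hgen 4 (((p.1 : ℕ) : ZMod 4) + 1))⁻¹).prod

namespace HG

/-! ### Codes for normal forms in the group `⟨a₁, a₂, a₃⟩` -/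

/-- numeric part of a letter: `((p, q, e), (k, l))` stands for `((p - q) / 2 ^ e, k - l)` -/
abbrev CN := (ℕ × ℕ × ℕ) × (ℕ × ℕ)
abbrev CL := Bool × CN
abbrev CC := List CL × (ℕ × ℕ)

def cz : CN := ((0, 0, 0), (0, 0))

def cpush (b : Bool) (x : CN) (l : List CL) : List CL :=
  if x.1.1 = x.1.2.1 ∧ x.2.1 = x.2.2 then l else (b, x) :: l

def cpop (b : Bool) (l : List CL) : CN × List CL :=
  match l with
  | [] => (cz, [])
  | a :: r => if a.1 = b then (a.2, r) else (cz, a :: r)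

def num1 (s : Bool) (x : CN) (n : ℕ × ℕ) : CN :=
  ((x.1.1 * 2 ^ n.2 + bif s then 2 ^ (x.1.2.2 + n.1) else 0,
    x.1.2.1 * 2 ^ n.2 + bif s then 0 else 2 ^ (x.1.2.2 + n.1),
    x.1.2.2 + n.2), x.2)

def cR1 (s : Bool) (c : CC) : CC :=
  (cpush true (num1 s (cpop true c.1).1 c.2) (cpop true c.1).2, c.2)

def cR2 (s : Bool) (c : CC) : CC :=
  (c.1, bif s then (c.2.1 + 1, c.2.2) else (c.2.1, c.2.2 + 1))

def tot3 (s : Bool) (x : CN) (n : ℕ × ℕ) : ℕ :=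
  bif s then x.1.1 + 2 ^ x.1.2.2 * n.1 + 2 ^ x.1.2.2 * n.2 + x.1.2.1 * (2 ^ (x.1.2.2 + 1) - 1)
  else 2 * x.1.1 + 2 * x.1.2.1 * (2 ^ x.1.2.2 - 1)

def exp3 (s : Bool) (x : CN) : ℕ := bif s then x.1.2.2 + 1 else x.1.2.2

def num3 (s : Bool) (x : CN) (n : ℕ × ℕ) : CN :=
  ((tot3 s x n % 2 ^ exp3 s x, 0, exp3 s x),
    bif s then (x.2.1 + 1, x.2.2) else (x.2.1, x.2.2 + 1))

def car3 (s : Bool) (x : CN) (n : ℕ × ℕ) : ℕ × ℕ :=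
  bif s then (tot3 s x n / 2 ^ exp3 s x, n.2 + x.1.2.1)
  else (2 * n.1 + tot3 s x n / 2 ^ exp3 s x, 2 * n.2 + 2 * x.1.2.1)

def cR3 (s : Bool) (c : CC) : CC :=
  (cpush false (num3 s (cpop false c.1).1 c.2) (cpop false c.1).2,
    car3 s (cpop false c.1).1 c.2)

def cstep (c : CC) (x : Fin 3 × Bool) : CC :=
  if x.1 = 0 then cR1 x.2 c else if x.1 = 1 then cR2 x.2 c else cR3 x.2 c

abbrev W3 := List (Fin 3 × Bool)

def crun (u : W3) : CC := u.foldl cstep ([], (0, 0))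

/-- the letter lies in `⟨a₁⟩` or `⟨a₃⟩` -/
def letS (a : CL) : Prop :=
  (a.1 = true ∧ a.2.1.1 % 2 ^ a.2.1.2.2 = a.2.1.2.1 % 2 ^ a.2.1.2.2) ∨
    (a.1 = false ∧ a.2.1.1 = a.2.1.2.1)

instance : DecidablePred letS := fun a => by unfold letS; infer_instance

def cS (c : CC) : Prop := (∀ a ∈ c.1, letS a) ∧ c.2.1 = c.2.2

instance : DecidablePred cS := fun a => by unfold cS; infer_instance

def rep {α : Type} (x : α) (n : ℕ) : List α := (List.range n).map fun _ => x

/-- the word in `a₁, a₃` of a letter, with the frame exchanging `0` and `2` -/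
def letW (a : CL) : W3 :=
  bif a.1 then rep (2, true) (a.2.1.1 / 2 ^ a.2.1.2.2) ++ rep (2, false) (a.2.1.2.1 / 2 ^ a.2.1.2.2)
  else rep (0, true) a.2.2.1 ++ rep (0, false) a.2.2.2

def cW (c : CC) : W3 := c.1.reverse.flatMap letW

/-! ### The stack algorithm for the amalgam -/

def frame (t : Bool) (i : Fin 4) : Option (Fin 3) :=
  bif t then ![some 0, some 1, some 2, none] i else ![some 2, none, some 0, some 1] i

abbrev ST := (Bool × W3) × List W3

def hstep (x : Fin 4 × Bool) (s : ST) : ST :=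
  match frame s.1.1 x.1 with
  | some j => ((s.1.1, (j, x.2) :: s.1.2), s.2)
  | none =>
    if cS (crun s.1.2) then
      ((!s.1.1, (1, x.2) :: (cW (crun s.1.2) ++ s.2.headI)), s.2.tail)
    else ((!s.1.1, [(1, x.2)]), s.1.2 :: s.2)

def hrun (w : List (Fin 4 × Bool)) : ST := w.foldr hstep ((true, []), [])

def isTriv (c : CC) : Prop := c.1 = [] ∧ c.2.1 = c.2.2

instance : DecidablePred isTriv := fun a => by unfold isTriv; infer_instance

def hdec (w : List (Fin 4 × Bool)) : Bool :=
  decide ((hrun w).2 = [] ∧ isTriv (crun (hrun w).1.2))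

/-! ### Computability -/

theorem pr_pow {α : Type} [Primcodable α] {f : α → ℕ} (hf : Primrec f) :
    Primrec fun a => 2 ^ f a :=
  (Primrec₂.unpaired'.1 Nat.Primrec.pow).comp (Primrec.const 2) hf

section comp
variable {α : Type} [Primcodable α]

theorem pr_p {x : α → CN} (hx : Primrec x) : Primrec fun a => (x a).1.1 :=
  Primrec.fst.comp (Primrec.fst.comp hx)
theorem pr_q {x : α → CN} (hx : Primrec x) : Primrec fun a => (x a).1.2.1 :=
  Primrec.fst.comp (Primrec.snd.comp (Primrec.fst.comp hx))
theorem pr_e {x : α → CN} (hx : Primrec x) : Primrec fun a => (x a).1.2.2 :=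
  Primrec.snd.comp (Primrec.snd.comp (Primrec.fst.comp hx))
theorem pr_k {x : α → CN} (hx : Primrec x) : Primrec fun a => (x a).2.1 :=
  Primrec.fst.comp (Primrec.snd.comp hx)
theorem pr_k' {x : α → CN} (hx : Primrec x) : Primrec fun a => (x a).2.2 :=
  Primrec.snd.comp (Primrec.snd.comp hx)

theorem pr_add {f g : α → ℕ} (hf : Primrec f) (hg : Primrec g) : Primrec fun a => f a + g a :=
  Primrec.nat_add.comp hf hg
theorem pr_mul {f g : α → ℕ} (hf : Primrec f) (hg : Primrec g) : Primrec fun a => f a * g a :=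
  Primrec.nat_mul.comp hf hg
theorem pr_sub {f g : α → ℕ} (hf : Primrec f) (hg : Primrec g) : Primrec fun a => f a - g a :=
  Primrec.nat_sub.comp hf hg
theorem pr_div {f g : α → ℕ} (hf : Primrec f) (hg : Primrec g) : Primrec fun a => f a / g a :=
  Primrec.nat_div.comp hf hg
theorem pr_mod {f g : α → ℕ} (hf : Primrec f) (hg : Primrec g) : Primrec fun a => f a % g a :=
  Primrec.nat_mod.comp hf hg
theorem pr_eq {β : Type} [Primcodable β] {f g : α → β} (hf : Primrec f) (hg : Primrec g) :
    PrimrecPred fun a => f a = g a :=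
  Primrec.eq.comp hf hg

theorem pr_num1 {s : α → Bool} {x : α → CN} {n : α → ℕ × ℕ} (hs : Primrec s) (hx : Primrec x)
    (hn : Primrec n) : Primrec fun a => num1 (s a) (x a) (n a) := by
  have h1 := Primrec.fst.comp hn
  have h2 := Primrec.snd.comp hn
  have hw := pr_pow (pr_add (pr_e hx) h1)
  have z := Primrec.const (α := α) 0
  exact ((pr_add (pr_mul (pr_p hx) (pr_pow h2)) (Primrec.cond hs hw z)).pair
    ((pr_add (pr_mul (pr_q hx) (pr_pow h2)) (Primrec.cond hs z hw)).pair
      (pr_add (pr_e hx) h2))).pair (Primrec.snd.comp hx)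

theorem pr_cpush {b : Bool} {x : α → CN} {l : α → List CL} (hx : Primrec x) (hl : Primrec l) :
    Primrec fun a => cpush b (x a) (l a) :=
  Primrec.ite ((pr_eq (pr_p hx) (pr_q hx)).and (pr_eq (pr_k hx) (pr_k' hx))) hl
    (Primrec.list_cons.comp ((Primrec.const b).pair hx) hl)

theorem pr_cpop {b : Bool} : Primrec (cpop b) := by
  have : Primrec fun l : List CL => (List.casesOn l (cz, ([] : List CL))
      (fun a r => if a.1 = b then (a.2, r) else (cz, a :: r)) : CN × List CL) := by
    refine Primrec.list_casesOn (f := fun l : List CL => l) (g := fun _ => (cz, ([] : List CL)))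
      (h := fun _ y => if y.1.1 = b then (y.1.2, y.2) else (cz, y.1 :: y.2))
      Primrec.id (Primrec.const _) ?_
    have h2 : Primrec fun y : List CL × (CL × List CL) => y.2 := Primrec.snd
    have ha := Primrec.fst.comp h2
    have hr := Primrec.snd.comp h2
    exact Primrec.ite (pr_eq (Primrec.fst.comp ha) (Primrec.const b))
      ((Primrec.snd.comp ha).pair hr)
      ((Primrec.const cz).pair (Primrec.list_cons.comp ha hr))
  exact this.of_eq fun l => by cases l <;> rfl

theorem pr_tot3 {s : α → Bool} {x : α → CN} {n : α → ℕ × ℕ} (hs : Primrec s) (hx : Primrec x)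
    (hn : Primrec n) : Primrec fun a => tot3 (s a) (x a) (n a) := by
  have h1 := Primrec.fst.comp hn
  have h2 := Primrec.snd.comp hn
  have o := Primrec.const (α := α) 1
  have t := Primrec.const (α := α) 2
  exact Primrec.cond hs
    (pr_add (pr_add (pr_add (pr_p hx) (pr_mul (pr_pow (pr_e hx)) h1))
      (pr_mul (pr_pow (pr_e hx)) h2))
      (pr_mul (pr_q hx) (pr_sub (pr_pow (pr_add (pr_e hx) o)) o)))
    (pr_add (pr_mul t (pr_p hx)) (pr_mul (pr_mul t (pr_q hx)) (pr_sub (pr_pow (pr_e hx)) o)))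

theorem pr_exp3 {s : α → Bool} {x : α → CN} (hs : Primrec s) (hx : Primrec x) :
    Primrec fun a => exp3 (s a) (x a) :=
  Primrec.cond hs (pr_add (pr_e hx) (Primrec.const 1)) (pr_e hx)

theorem pr_num3 {s : α → Bool} {x : α → CN} {n : α → ℕ × ℕ} (hs : Primrec s) (hx : Primrec x)
    (hn : Primrec n) : Primrec fun a => num3 (s a) (x a) (n a) := by
  have o := Primrec.const (α := α) 1
  exact ((pr_mod (pr_tot3 hs hx hn) (pr_pow (pr_exp3 hs hx))).pair
    ((Primrec.const 0).pair (pr_exp3 hs hx))).pair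
    (Primrec.cond hs ((pr_add (pr_k hx) o).pair (pr_k' hx))
      ((pr_k hx).pair (pr_add (pr_k' hx) o)))

theorem pr_car3 {s : α → Bool} {x : α → CN} {n : α → ℕ × ℕ} (hs : Primrec s) (hx : Primrec x)
    (hn : Primrec n) : Primrec fun a => car3 (s a) (x a) (n a) := by
  have h1 := Primrec.fst.comp hn
  have h2 := Primrec.snd.comp hn
  have t := Primrec.const (α := α) 2
  have d := pr_div (pr_tot3 hs hx hn) (pr_pow (pr_exp3 hs hx))
  exact Primrec.cond hs (d.pair (pr_add h2 (pr_q hx)))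
    ((pr_add (pr_mul t h1) d).pair (pr_add (pr_mul t h2) (pr_mul t (pr_q hx))))

theorem pr_cR1 {s : α → Bool} {c : α → CC} (hs : Primrec s) (hc : Primrec c) :
    Primrec fun a => cR1 (s a) (c a) := by
  have hl := Primrec.fst.comp hc
  have hn := Primrec.snd.comp hc
  have hp := (pr_cpop (b := true)).comp hl
  exact (pr_cpush (pr_num1 hs (Primrec.fst.comp hp) hn) (Primrec.snd.comp hp)).pair hn

theorem pr_cR2 {s : α → Bool} {c : α → CC} (hs : Primrec s) (hc : Primrec c) :
    Primrec fun a => cR2 (s a) (c a) := by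
  have hl := Primrec.fst.comp hc
  have hn := Primrec.snd.comp hc
  have h1 := Primrec.fst.comp hn
  have h2 := Primrec.snd.comp hn
  have o := Primrec.const (α := α) 1
  exact hl.pair (Primrec.cond hs ((pr_add h1 o).pair h2) (h1.pair (pr_add h2 o)))

theorem pr_cR3 {s : α → Bool} {c : α → CC} (hs : Primrec s) (hc : Primrec c) :
    Primrec fun a => cR3 (s a) (c a) := by
  have hl := Primrec.fst.comp hc
  have hn := Primrec.snd.comp hc
  have hp := (pr_cpop (b := false)).comp hl
  exact (pr_cpush (pr_num3 hs (Primrec.fst.comp hp) hn) (Primrec.snd.comp hp)).pair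
    (pr_car3 hs (Primrec.fst.comp hp) hn)

theorem pr_cstep {c : α → CC} {x : α → Fin 3 × Bool} (hc : Primrec c) (hx : Primrec x) :
    Primrec fun a => cstep (c a) (x a) := by
  have hs := Primrec.snd.comp hx
  have hi := Primrec.fst.comp hx
  exact Primrec.ite (pr_eq hi (Primrec.const 0)) (pr_cR1 hs hc)
    (Primrec.ite (pr_eq hi (Primrec.const 1)) (pr_cR2 hs hc) (pr_cR3 hs hc))

theorem pr_crun : Primrec crun :=
  Primrec.list_foldl (f := fun u : W3 => u) (g := fun _ => (([], (0, 0)) : CC))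
    (h := fun _ y => cstep y.1 y.2) Primrec.id (Primrec.const _)
    (pr_cstep (Primrec.fst.comp Primrec.snd) (Primrec.snd.comp Primrec.snd))

theorem pr_letS : PrimrecPred letS := by
  have hx : Primrec fun a : CL => a.2 := Primrec.snd
  have hb : Primrec fun a : CL => a.1 := Primrec.fst
  exact ((pr_eq hb (Primrec.const true)).and
    (pr_eq (pr_mod (pr_p hx) (pr_pow (pr_e hx))) (pr_mod (pr_q hx) (pr_pow (pr_e hx))))).or
    ((pr_eq hb (Primrec.const false)).and (pr_eq (pr_p hx) (pr_q hx)))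

theorem pr_cS : PrimrecPred cS := by
  have h := (PrimrecPred.forall_mem_list pr_letS).comp (Primrec.fst (α := List CL) (β := ℕ × ℕ))
  exact h.and (pr_eq (Primrec.fst.comp Primrec.snd) (Primrec.snd.comp Primrec.snd))

theorem pr_rep {β : Type} [Primcodable β] (x : β) {n : α → ℕ} (hn : Primrec n) :
    Primrec fun a => rep x (n a) :=
  Primrec.list_map (Primrec.list_range.comp hn) (Primrec.const x).to₂

theorem pr_letW : Primrec letW := by
  have hx : Primrec fun a : CL => a.2 := Primrec.snd
  have hb : Primrec fun a : CL => a.1 := Primrec.fst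
  exact Primrec.cond hb
    (Primrec.list_append.comp (pr_rep _ (pr_div (pr_p hx) (pr_pow (pr_e hx))))
      (pr_rep _ (pr_div (pr_q hx) (pr_pow (pr_e hx)))))
    (Primrec.list_append.comp (pr_rep _ (pr_k hx)) (pr_rep _ (pr_k' hx)))

theorem pr_cW : Primrec cW :=
  Primrec.list_flatMap (Primrec.list_reverse.comp Primrec.fst) (pr_letW.comp Primrec.snd)

theorem pr_hstep : Primrec fun y : (Fin 4 × Bool) × ST => hstep y.1 y.2 := by
  have hx : Primrec fun y : (Fin 4 × Bool) × ST => y.1 := Primrec.fst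
  have hs : Primrec fun y : (Fin 4 × Bool) × ST => y.2 := Primrec.snd
  have ht := Primrec.fst.comp (Primrec.fst.comp hs)
  have hu := Primrec.snd.comp (Primrec.fst.comp hs)
  have hr := Primrec.snd.comp hs
  have hi := Primrec.fst.comp hx
  have hb := Primrec.snd.comp hx
  have hf : Primrec fun y : (Fin 4 × Bool) × ST => frame y.2.1.1 y.1.1 :=
    (Primrec.dom_finite (fun z : Bool × Fin 4 => frame z.1 z.2)).comp (ht.pair hi)
  have hnt := Primrec.not.comp ht
  have hc := pr_crun.comp hu
  have hone : Primrec fun y : (Fin 4 × Bool) × ST => ((1 : Fin 3), y.1.2) :=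
    (Primrec.const 1).pair hb
  have hsome : Primrec₂ fun (y : (Fin 4 × Bool) × ST) (j : Fin 3) =>
      (((y.2.1.1, (j, y.1.2) :: y.2.1.2), y.2.2) : ST) := by
    have p1 : Primrec fun z : ((Fin 4 × Bool) × ST) × Fin 3 => z.1 := Primrec.fst
    have p2 : Primrec fun z : ((Fin 4 × Bool) × ST) × Fin 3 => z.2 := Primrec.snd
    exact ((ht.comp p1).pair (Primrec.list_cons.comp (p2.pair (hb.comp p1)) (hu.comp p1))).pair
      (hr.comp p1)
  have hnone : Primrec fun y : (Fin 4 × Bool) × ST =>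
      (if cS (crun y.2.1.2) then
        ((!y.2.1.1, (1, y.1.2) :: (cW (crun y.2.1.2) ++ y.2.2.headI)), y.2.2.tail)
      else ((!y.2.1.1, [(1, y.1.2)]), y.2.1.2 :: y.2.2) : ST) :=
    Primrec.ite (pr_cS.comp hc)
      ((hnt.pair (Primrec.list_cons.comp hone
        (Primrec.list_append.comp (pr_cW.comp hc) (Primrec.list_headI.comp hr)))).pair
        (Primrec.list_tail.comp hr))
      ((hnt.pair (Primrec.list_cons.comp hone (Primrec.const []))).pair
        (Primrec.list_cons.comp hu hr))
  exact (Primrec.option_casesOn hf hnone hsome).of_eq fun y => by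
    unfold hstep; cases frame y.2.1.1 y.1.1 <;> rfl

theorem pr_hrun : Primrec hrun :=
  Primrec.list_foldr (f := fun u : List (Fin 4 × Bool) => u)
    (g := fun _ => (((true, []), []) : ST))
    (h := fun _ y => hstep y.1 y.2) Primrec.id (Primrec.const _)
    (pr_hstep.comp Primrec.snd)

theorem pr_isTriv : PrimrecPred isTriv :=
  (pr_eq Primrec.fst (Primrec.const [])).and
    (pr_eq (Primrec.fst.comp Primrec.snd) (Primrec.snd.comp Primrec.snd))

theorem pr_hdec : Primrec hdec :=
  ((pr_eq (Primrec.snd.comp pr_hrun) (Primrec.const [])).and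
    (pr_isTriv.comp (pr_crun.comp (Primrec.snd.comp (Primrec.fst.comp pr_hrun))))).decide

end comp


/-! ### Evaluation of codes in groups -/

def sg (s : Bool) : ℤ := bif s then 1 else -1

section eval
variable {Γ : Type*} [Group Γ]

def bs (a b : Γ) (j : ℤ) (e : ℕ) : Γ := (b ^ e)⁻¹ * a ^ j * b ^ e

theorem bs_add (a b : Γ) (i j : ℤ) (e : ℕ) : bs a b i e * bs a b j e = bs a b (i + j) e := by
  unfold bs; rw [zpow_add]; group

theorem bs_zero (a b : Γ) (e : ℕ) : bs a b 0 e = 1 := by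
  unfold bs; simp

theorem conj_step {a b : Γ} (h : b * a * b⁻¹ = a ^ 2) (j : ℤ) : b * a ^ j * b⁻¹ = a ^ (j * 2) := by
  rw [← conj_zpow, h, ← zpow_natCast, ← zpow_mul, mul_comm]; rfl

theorem conj_pow_step {a b : Γ} (h : b * a * b⁻¹ = a ^ 2) (j : ℤ) (m : ℕ) :
    b ^ m * a ^ j * (b ^ m)⁻¹ = a ^ (j * 2 ^ m) := by
  induction m generalizing j with
  | zero => simp
  | succ m ih =>
    have : b ^ (m + 1) * a ^ j * (b ^ (m + 1))⁻¹ = b ^ m * (b * a ^ j * b⁻¹) * (b ^ m)⁻¹ := by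
      rw [pow_succ]; group
    rw [this, conj_step h, ih]
    congr 1; ring

theorem bs_shift {a b : Γ} (h : b * a * b⁻¹ = a ^ 2) (j : ℤ) (e m : ℕ) :
    bs a b (j * 2 ^ m) (e + m) = bs a b j e := by
  unfold bs; rw [← conj_pow_step h, pow_add]
  have : b ^ e * b ^ m = b ^ m * b ^ e := by rw [← pow_add, ← pow_add, add_comm]
  rw [this]; group

theorem bs_int {a b : Γ} (h : b * a * b⁻¹ = a ^ 2) (j : ℤ) (e : ℕ) :
    bs a b (j * 2 ^ e) e = a ^ j := by
  have := bs_shift h j 0 e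
  rw [zero_add] at this; rw [this]; simp [bs]

variable (g : Fin 3 → Γ)

def evL (a : CL) : Γ :=
  bif a.1 then bs (g 0) (g 1) ((a.2.1.1 : ℤ) - a.2.1.2.1) a.2.1.2.2
  else (g 2) ^ ((a.2.2.1 : ℤ) - a.2.2.2) * bs (g 1) (g 2) ((a.2.1.1 : ℤ) - a.2.1.2.1) a.2.1.2.2

def evList : List CL → Γ
  | [] => 1
  | a :: l => evList l * evL g a

def evC (c : CC) : Γ := evList g c.1 * (g 1) ^ ((c.2.1 : ℤ) - c.2.2)

theorem evL_zero (b : Bool) (x : CN) (h : x.1.1 = x.1.2.1 ∧ x.2.1 = x.2.2) : evL g (b, x) = 1 := by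
  cases b <;> simp [evL, h.1, h.2, bs_zero]

theorem evList_push (b : Bool) (x : CN) (l : List CL) :
    evList g (cpush b x l) = evList g l * evL g (b, x) := by
  unfold cpush
  split_ifs with h
  · rw [evL_zero g b x h, mul_one]
  · rfl

theorem evList_pop (b : Bool) (l : List CL) :
    evList g (cpop b l).2 * evL g (b, (cpop b l).1) = evList g l := by
  have hz : evL g (b, cz) = 1 := evL_zero g b cz ⟨rfl, rfl⟩
  cases l with
  | nil => simp [cpop, hz]
  | cons a r =>
    unfold cpop
    by_cases h : a.1 = b
    · subst h; simp [evList]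
    · simp [h, hz]

variable {g}

theorem ev_num1 (h1 : g 1 * g 0 * (g 1)⁻¹ = g 0 ^ 2)
    (s : Bool) (x : CN) (n : ℕ × ℕ) :
    evL g (true, num1 s x n) * (g 1) ^ ((n.1 : ℤ) - n.2) =
      evL g (true, x) * (g 1) ^ ((n.1 : ℤ) - n.2) * (g 0) ^ sg s := by
  obtain ⟨⟨p, q, e⟩, k, k'⟩ := x
  obtain ⟨n, n'⟩ := n
  have key : (g 1) ^ ((n : ℤ) - n') * (g 0) ^ sg s * ((g 1) ^ ((n : ℤ) - n'))⁻¹ =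
      bs (g 0) (g 1) (sg s * 2 ^ (e + n)) (e + n') := by
    have e1 : bs (g 0) (g 1) (sg s * 2 ^ (e + n)) (e + n') =
        bs (g 0) (g 1) (sg s * 2 ^ n) n' := by
      have := bs_shift h1 (sg s * 2 ^ n) n' e
      rw [← this, add_comm n' e]; congr 1; ring
    rw [e1, bs, ← conj_pow_step h1, zpow_sub, zpow_natCast, zpow_natCast]
    have : Commute (g 1 ^ n) (g 1 ^ n') := (Commute.refl _).pow_pow n n'
    rw [this.inv_right.eq]; group
  have l1 : evL g (true, num1 s ((p, q, e), k, k') (n, n')) =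
      bs (g 0) (g 1) ((p : ℤ) - q) e * bs (g 0) (g 1) (sg s * 2 ^ (e + n)) (e + n') := by
    rw [← bs_shift h1 ((p : ℤ) - q) e n', bs_add]
    cases s <;> simp [evL, num1, sg] <;> congr 1 <;> ring
  rw [l1, ← key]
  simp [evL, mul_assoc]

theorem ev_num3 (h2 : g 2 * g 1 * (g 2)⁻¹ = g 1 ^ 2)
    (s : Bool) (x : CN) (n : ℕ × ℕ) :
    evL g (false, num3 s x n) * (g 1) ^ (((car3 s x n).1 : ℤ) - (car3 s x n).2) =
      evL g (false, x) * (g 1) ^ ((n.1 : ℤ) - n.2) * (g 2) ^ sg s := by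
  obtain ⟨⟨p, q, e⟩, k, k'⟩ := x
  obtain ⟨n, n'⟩ := n
  have rhs : evL g (false, (p, q, e), k, k') * (g 1) ^ ((n : ℤ) - n') =
      g 2 ^ ((k : ℤ) - k') * bs (g 1) (g 2) ((p : ℤ) - q + (n - n') * 2 ^ e) e := by
    rw [← bs_add, bs_int h2]; simp [evL, mul_assoc]
  have pos : ∀ m : ℕ, 1 ≤ 2 ^ m := fun m => Nat.one_le_two_pow
  simp only [rhs]
  have lhs : ∀ (P E K K' N N' : ℕ), evL g (false, (P, 0, E), K, K') * (g 1) ^ ((N : ℤ) - N') =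
      g 2 ^ ((K : ℤ) - K') * bs (g 1) (g 2) ((P : ℤ) + (N - N') * 2 ^ E) E := by
    intro P E K K' N N'
    rw [← bs_add, bs_int h2]; simp [evL, mul_assoc]
  cases s with
  | true =>
    set T := tot3 true ((p, q, e), k, k') (n, n') with hT
    have hT' : (T : ℤ) = p + 2 ^ e * n + 2 ^ e * n' + q * (2 ^ (e + 1) - 1) := by
      simp only [hT, tot3, cond_true]; push_cast [pos (e + 1)]; ring
    have hd : ((T % 2 ^ (e + 1) : ℕ) : ℤ) + 2 ^ (e + 1) * ((T / 2 ^ (e + 1) : ℕ) : ℤ) = T := by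
      exact_mod_cast Nat.mod_add_div T (2 ^ (e + 1))
    have e1 := lhs (T % 2 ^ (e + 1)) (e + 1) (k + 1) k' (T / 2 ^ (e + 1)) (n' + q)
    simp only [num3, car3, exp3, cond_true, ← hT]
    refine e1.trans ?_
    have : ((T % 2 ^ (e + 1) : ℕ) : ℤ) + (((T / 2 ^ (e + 1) : ℕ) : ℤ) - ((n' + q : ℕ) : ℤ)) * 2 ^ (e + 1)
        = p - q + (n - n') * 2 ^ e := by
      push_cast at hd ⊢; rw [pow_succ] at *; linarith
    rw [this]
    simp only [bs, sg, cond_true, zpow_one, pow_succ]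
    have : g 2 ^ (((k + 1 : ℕ) : ℤ) - k') = g 2 ^ ((k : ℤ) - k') * g 2 := by
      rw [← zpow_add_one]; congr 1; push_cast; ring
    rw [this]
    have c : g 2 ^ e * g 2 = g 2 * g 2 ^ e := by rw [← pow_succ, ← pow_succ']
    rw [mul_inv_rev]
    simp only [mul_assoc]
    simp
  | false =>
    set T := tot3 false ((p, q, e), k, k') (n, n') with hT
    have hT' : (T : ℤ) = 2 * p + 2 * q * (2 ^ e - 1) := by
      simp only [hT, tot3, cond_false]; push_cast [pos e]; ring
    have hd : ((T % 2 ^ e : ℕ) : ℤ) + 2 ^ e * ((T / 2 ^ e : ℕ) : ℤ) = T := by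
      exact_mod_cast Nat.mod_add_div T (2 ^ e)
    have e1 := lhs (T % 2 ^ e) e k (k' + 1) (2 * n + T / 2 ^ e) (2 * n' + 2 * q)
    simp only [num3, car3, exp3, cond_false, ← hT]
    refine e1.trans ?_
    have : ((T % 2 ^ e : ℕ) : ℤ) + (((2 * n + T / 2 ^ e : ℕ) : ℤ) - ((2 * n' + 2 * q : ℕ) : ℤ)) * 2 ^ e
        = (p - q + (n - n') * 2 ^ e) * 2 ^ 1 := by
      push_cast at hd ⊢; linarith
    rw [this]
    have hs := bs_shift h2 ((p : ℤ) - q + (n - n') * 2 ^ e) e 1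
    have hb : ∀ j : ℤ, g 2 ^ (-1 : ℤ) * bs (g 1) (g 2) j e = bs (g 1) (g 2) j (e + 1) * g 2 ^ (-1 : ℤ) := by
      intro j
      simp only [bs, pow_succ, mul_inv_rev, zpow_neg, zpow_one]
      have c : g 2 ^ e * g 2 = g 2 * g 2 ^ e := by rw [← pow_succ, ← pow_succ']
      have c' : (g 2)⁻¹ * (g 2 ^ e)⁻¹ = (g 2 ^ e)⁻¹ * (g 2)⁻¹ := by
        rw [← mul_inv_rev, ← mul_inv_rev, c]
      simp only [mul_assoc]
      simp
    have hk : g 2 ^ ((k : ℤ) - ((k' + 1 : ℕ) : ℤ)) = g 2 ^ ((k : ℤ) - k') * g 2 ^ (-1 : ℤ) := by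
      rw [← zpow_add]; congr 1; push_cast; ring
    rw [hk, mul_assoc, hb, hs]
    simp [sg, mul_assoc]

def wval (g : Fin 3 → Γ) (u : W3) : Γ :=
  (u.map fun x => g x.1 ^ sg x.2).prod

theorem wval_append (u v : W3) : wval g (u ++ v) = wval g u * wval g v := by
  simp [wval]

theorem ev_step (h1 : g 1 * g 0 * (g 1)⁻¹ = g 0 ^ 2)
    (h2 : g 2 * g 1 * (g 2)⁻¹ = g 1 ^ 2)
    (c : CC) (x : Fin 3 × Bool) : evC g (cstep c x) = evC g c * g x.1 ^ sg x.2 := by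
  obtain ⟨i, s⟩ := x
  obtain ⟨l, n⟩ := c
  fin_cases i
  · simp only [cstep, evC, cR1]
    simp only [Fin.zero_eta, if_true, evList_push]
    rw [mul_assoc, ev_num1 h1, ← evList_pop g true l]
    simp only [mul_assoc]
  · have e1 : (1 : Fin 3) ≠ 0 := by decide
    cases s <;> simp [cstep, evC, cR2, sg, mul_assoc, e1, ← zpow_sub_one, ← zpow_add_one] <;>
      congr 1 <;> ring
  · have e1 : (2 : Fin 3) ≠ 0 := by decide
    have e2 : (2 : Fin 3) ≠ 1 := by decide
    simp only [cstep, evC, cR3]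
    simp only [Fin.reduceFinMk, e1, e2, if_false, evList_push]
    rw [mul_assoc, ev_num3 h2, ← evList_pop g false l]
    simp only [mul_assoc]

theorem ev_run (h1 : g 1 * g 0 * (g 1)⁻¹ = g 0 ^ 2)
    (h2 : g 2 * g 1 * (g 2)⁻¹ = g 1 ^ 2)
    (u : W3) : evC g (crun u) = wval g u := by
  have : ∀ (u : W3) (c : CC), evC g (u.foldl cstep c) = evC g c * wval g u := by
    intro u
    induction u with
    | nil => simp [wval]
    | cons x u ih =>
      intro c
      rw [List.foldl_cons, ih, ev_step h1 h2]
      simp [wval, mul_assoc]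
  rw [crun, this]; simp [evC, evList]

end eval

theorem wval_rep {Γ : Type*} [Group Γ] (g : Fin 3 → Γ) (x : Fin 3 × Bool) (n : ℕ) :
    wval g (rep x n) = g x.1 ^ (sg x.2 * n) := by
  simp [wval, rep, zpow_mul]

/-- frames with the outer generators exchanged -/
def sw {Γ : Type*} (g : Fin 3 → Γ) : Fin 3 → Γ := ![g 2, g 1, g 0]

section eval2
variable {Γ : Type*} [Group Γ] {g : Fin 3 → Γ}

theorem wval_letW (h1 : g 1 * g 0 * (g 1)⁻¹ = g 0 ^ 2)
    (a : CL) (ha : letS a) : wval (sw g) (letW a) = evL g a := by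
  obtain ⟨b, ⟨p, q, e⟩, k, k'⟩ := a
  cases b with
  | true =>
    simp only [letS, Bool.true_eq_false, false_and, or_false, true_and] at ha
    simp only [letW, cond_true, wval_append, wval_rep, evL]
    have hp : ((p % 2 ^ e : ℕ) : ℤ) + 2 ^ e * ((p / 2 ^ e : ℕ) : ℤ) = p := by
      exact_mod_cast Nat.mod_add_div p (2 ^ e)
    have hq : ((q % 2 ^ e : ℕ) : ℤ) + 2 ^ e * ((q / 2 ^ e : ℕ) : ℤ) = q := by
      exact_mod_cast Nat.mod_add_div q (2 ^ e)
    have : (p : ℤ) - q = (((p / 2 ^ e : ℕ) : ℤ) - ((q / 2 ^ e : ℕ) : ℤ)) * 2 ^ e := by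
      rw [ha] at hp; linarith
    rw [this, bs_int h1, ← zpow_add]
    simp only [sw, sg]
    simp [sub_eq_add_neg]
  | false =>
    simp only [letS, Bool.false_eq_true, false_and, false_or, true_and] at ha
    simp [letW, wval_append, wval_rep, evL, ha, bs_zero, sw, sg, sub_eq_add_neg, zpow_add]

theorem wval_cW (h1 : g 1 * g 0 * (g 1)⁻¹ = g 0 ^ 2)
    (c : CC) (hc : cS c) : wval (sw g) (cW c) = evC g c := by
  obtain ⟨l, n, n'⟩ := c
  obtain ⟨hl, hn⟩ := hc
  simp only at hl hn
  simp only [evC, hn, sub_self, zpow_zero, mul_one]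
  simp only [cW]
  clear hn
  induction l with
  | nil => simp [wval, evList]
  | cons a l ih =>
    simp only [List.reverse_cons, List.flatMap_append, wval_append, evList]
    rw [ih (fun b hb => hl b (List.mem_cons_of_mem _ hb))]
    simp [wval_letW h1 a (hl a List.mem_cons_self)]

end eval2


/-! ### The semantic normal forms and the permutation action on them -/

abbrev SN := ℚ × ℤ
abbrev SL := Bool × SN
abbrev SS := List SL × ℤ

def spush (b : Bool) (x : SN) (l : List SL) : List SL := if x = 0 then l else (b, x) :: l

def spop (b : Bool) (l : List SL) : SN × List SL :=
  match l with
  | [] => (0, [])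
  | a :: r => if a.1 = b then (a.2, r) else (0, a :: r)

def nh (b : Bool) (l : List SL) : Prop := ∀ a ∈ l.head?, a.1 ≠ b

def okN (b : Bool) (x : SN) : Prop := b = false → 0 ≤ x.1 ∧ x.1 < 1

def V : List SL → Prop
  | [] => True
  | a :: l => a.2 ≠ 0 ∧ okN a.1 a.2 ∧ nh a.1 l ∧ V l

theorem pop_push (b : Bool) (x : SN) (r : List SL) (h : nh b r) :
    spop b (spush b x r) = (x, r) := by
  unfold spush
  split_ifs with hx
  · subst hx
    cases r with
    | nil => rfl
    | cons a r =>
      have : a.1 ≠ b := h a (by simp)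
      simp [spop, this]
  · simp [spop]

theorem push_pop (b : Bool) (l : List SL) (h : V l) :
    spush b (spop b l).1 (spop b l).2 = l := by
  cases l with
  | nil => simp [spop, spush]
  | cons a r =>
    unfold spop
    by_cases hb : a.1 = b
    · subst hb; simp [spush, h.1]
    · simp [hb, spush]

theorem pop_V (b : Bool) (l : List SL) (h : V l) :
    V (spop b l).2 ∧ nh b (spop b l).2 ∧ okN b (spop b l).1 := by
  cases l with
  | nil => simp [spop, V, nh, okN]
  | cons a r =>
    unfold spop
    by_cases hb : a.1 = b
    · subst hb; simp [h.2.1, h.2.2.1, h.2.2.2]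
    · simp [hb, okN, nh, h]

theorem push_V (b : Bool) (x : SN) (l : List SL) (h : V l) (hn : nh b l) (hx : okN b x) :
    V (spush b x l) := by
  unfold spush
  split_ifs with h0
  · exact h
  · exact ⟨h0, hx, hn, h⟩

def sR1 (ε : ℤ) (c : SS) : SS :=
  (spush true ((spop true c.1).1.1 + ε * 2 ^ c.2, (spop true c.1).1.2) (spop true c.1).2, c.2)

def sR2 (ε : ℤ) (c : SS) : SS := (c.1, c.2 + ε)

def w3 (ε : ℤ) (x : SN) (n : ℤ) : ℚ := (x.1 + n) * 2 ^ (-ε)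

def sR3 (ε : ℤ) (c : SS) : SS :=
  (spush false (Int.fract (w3 ε (spop false c.1).1 c.2), (spop false c.1).1.2 + ε)
    (spop false c.1).2, ⌊w3 ε (spop false c.1).1 c.2⌋)

theorem sR1_V (ε : ℤ) (c : SS) (h : V c.1) : V (sR1 ε c).1 := by
  obtain ⟨a, b, d⟩ := pop_V true c.1 h
  exact push_V _ _ _ a b (by simp [okN])

theorem sR3_V (ε : ℤ) (c : SS) (h : V c.1) : V (sR3 ε c).1 := by
  obtain ⟨a, b, d⟩ := pop_V false c.1 h
  exact push_V _ _ _ a b (fun _ => ⟨Int.fract_nonneg _, Int.fract_lt_one _⟩)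

theorem sR1_add (ε δ : ℤ) (c : SS) (h : V c.1) : sR1 δ (sR1 ε c) = sR1 (ε + δ) c := by
  obtain ⟨a, b, d⟩ := pop_V true c.1 h
  simp only [sR1, pop_push _ _ _ b]
  push_cast
  rw [add_assoc, add_mul]

theorem sR1_zero (c : SS) (h : V c.1) : sR1 0 c = c := by
  have := push_pop true c.1 h
  simp [sR1, this]

theorem sR3_add (ε δ : ℤ) (c : SS) (h : V c.1) : sR3 δ (sR3 ε c) = sR3 (ε + δ) c := by
  obtain ⟨a, b, d⟩ := pop_V false c.1 h
  have : ∀ (x : SN) (n : ℤ), w3 δ (Int.fract (w3 ε x n), x.2 + ε) ⌊w3 ε x n⌋ = w3 (ε + δ) x n := by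
    intro x n
    have h2 : (2 : ℚ) ≠ 0 := by norm_num
    rw [w3, Int.fract_add_floor, w3, w3, mul_assoc, ← zpow_add₀ h2]
    congr 2; ring
  simp only [sR3, pop_push _ _ _ b, this, add_assoc]

theorem sR3_zero (c : SS) (h : V c.1) : sR3 0 c = c := by
  obtain ⟨a, b, d⟩ := pop_V false c.1 h
  have hp := push_pop false c.1 h
  obtain ⟨l, n⟩ := c
  simp only at *
  set x := (spop false l).1
  obtain ⟨d1, d2⟩ := d rfl
  have hf : Int.fract x.1 = x.1 := Int.fract_eq_self.2 ⟨d1, d2⟩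
  have hfl : ⌊x.1⌋ = 0 := Int.floor_eq_zero_iff.2 ⟨d1, d2⟩
  have hw : w3 0 x n = x.1 + n := by simp [w3]
  simp only [sR3]
  change (spush false (Int.fract (w3 0 x n), x.2 + 0) _, ⌊w3 0 x n⌋) = _
  rw [hw, Int.fract_add_intCast, Int.floor_add_intCast, hf, hfl, add_zero, zero_add, hp]

theorem rel1 (c : SS) (_h : V c.1) : sR2 (-1) (sR1 1 (sR2 1 c)) = sR1 2 c := by
  have h2 : (2 : ℚ) ≠ 0 := by norm_num
  simp only [sR2, sR1, zpow_add₀ h2, zpow_one, Int.cast_one, one_mul, Int.cast_ofNat, mul_comm]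
  simp

theorem rel2 (c : SS) (h : V c.1) : sR3 (-1) (sR2 1 (sR3 1 c)) = sR2 2 c := by
  have h3 : sR3 (-1) (sR2 1 (sR3 1 c)) = sR2 2 (sR3 0 c) := by
    obtain ⟨a, b, d⟩ := pop_V false c.1 h
    have : ∀ (x : SN) (n : ℤ), w3 (-1) (Int.fract (w3 1 x n), x.2 + 1) (⌊w3 1 x n⌋ + 1) =
        w3 0 x n + (2 : ℤ) := by
      intro x n
      rw [w3]; push_cast
      rw [← add_assoc, Int.fract_add_floor, w3, w3]
      norm_num
      ring
    simp only [sR3, sR2, pop_push _ _ _ b, this, Int.fract_add_intCast, Int.floor_add_intCast]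
    simp
  rw [h3, sR3_zero c h]

abbrev X := {c : SS // V c.1}

def e1 : Equiv.Perm X where
  toFun c := ⟨sR1 1 c.1, sR1_V _ _ c.2⟩
  invFun c := ⟨sR1 (-1) c.1, sR1_V _ _ c.2⟩
  left_inv c := Subtype.ext (by simp only [sR1_add _ _ _ c.2]; exact sR1_zero _ c.2)
  right_inv c := Subtype.ext (by simp only [sR1_add _ _ _ c.2]; exact sR1_zero _ c.2)

def e2 : Equiv.Perm X where
  toFun c := ⟨sR2 1 c.1, c.2⟩
  invFun c := ⟨sR2 (-1) c.1, c.2⟩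
  left_inv c := Subtype.ext (by simp [sR2])
  right_inv c := Subtype.ext (by simp [sR2])

def e3 : Equiv.Perm X where
  toFun c := ⟨sR3 1 c.1, sR3_V _ _ c.2⟩
  invFun c := ⟨sR3 (-1) c.1, sR3_V _ _ c.2⟩
  left_inv c := Subtype.ext (by simp only [sR3_add _ _ _ c.2]; exact sR3_zero _ c.2)
  right_inv c := Subtype.ext (by simp only [sR3_add _ _ _ c.2]; exact sR3_zero _ c.2)

abbrev GG := (Equiv.Perm X)ᵐᵒᵖ

def gA : Fin 3 → GG := ![MulOpposite.op e1, MulOpposite.op e2, MulOpposite.op e3]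

theorem gA_rel1 : gA 1 * gA 0 * (gA 1)⁻¹ = gA 0 ^ 2 := by
  apply MulOpposite.unop_injective
  ext1 c
  apply Subtype.ext
  change sR2 (-1) (sR1 1 (sR2 1 c.1)) = sR1 1 (sR1 1 c.1)
  rw [rel1 _ c.2, sR1_add _ _ _ c.2]; rfl

theorem gA_rel2 : gA 2 * gA 1 * (gA 2)⁻¹ = gA 1 ^ 2 := by
  apply MulOpposite.unop_injective
  ext1 c
  apply Subtype.ext
  change sR3 (-1) (sR2 1 (sR3 1 c.1)) = sR2 1 (sR2 1 c.1)
  rw [rel2 _ c.2]; simp [sR2, add_assoc]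

def sstep (c : SS) (x : Fin 3 × Bool) : SS :=
  if x.1 = 0 then sR1 (sg x.2) c else if x.1 = 1 then sR2 (sg x.2) c else sR3 (sg x.2) c

theorem gA_act (x : Fin 3 × Bool) (c : X) :
    (((gA x.1 ^ sg x.2).unop c : X) : SS) = sstep c.1 x := by
  obtain ⟨i, s⟩ := x
  fin_cases i <;> cases s <;> simp [sg, sstep, gA] <;> rfl

def x0 : X := ⟨([], 0), trivial⟩

theorem gA_run (u : W3) : (((wval gA u).unop x0 : X) : SS) = u.foldl sstep x0.1 := by
  have : ∀ (u : W3) (c : X), (((wval gA u).unop c : X) : SS) = u.foldl sstep c.1 := by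
    intro u
    induction u with
    | nil => intro c; rfl
    | cons x u ih =>
      intro c
      rw [List.foldl_cons, ← gA_act, ← ih]
      simp [wval]
  exact this u x0

/-! ### Codes versus semantic normal forms -/

def semN (x : CN) : SN := (((x.1.1 : ℚ) - x.1.2.1) / 2 ^ x.1.2.2, (x.2.1 : ℤ) - x.2.2)
def semL (l : List CL) : List SL := l.map fun a => (a.1, semN a.2)
def sem (c : CC) : SS := (semL c.1, (c.2.1 : ℤ) - c.2.2)

theorem semN_zero (x : CN) : semN x = 0 ↔ x.1.1 = x.1.2.1 ∧ x.2.1 = x.2.2 := by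
  simp only [semN, Prod.ext_iff, Prod.fst_zero, Prod.snd_zero]
  rw [div_eq_zero_iff, sub_eq_zero, sub_eq_zero]
  simp

theorem sem_push (b : Bool) (x : CN) (l : List CL) :
    semL (cpush b x l) = spush b (semN x) (semL l) := by
  unfold cpush spush
  simp only [semN_zero]
  split_ifs <;> simp [semL]

theorem sem_pop (b : Bool) (l : List CL) :
    spop b (semL l) = (semN (cpop b l).1, semL (cpop b l).2) := by
  have : semN cz = 0 := (semN_zero cz).2 ⟨rfl, rfl⟩
  cases l with
  | nil => simp [cpop, spop, semL, this]
  | cons a r =>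
    by_cases h : a.1 = b
    · simp [cpop, spop, semL, h]
    · simp [cpop, spop, semL, h, this]

theorem sem_num1 (s : Bool) (x : CN) (n : ℕ × ℕ) :
    semN (num1 s x n) = ((semN x).1 + sg s * 2 ^ ((n.1 : ℤ) - n.2), (semN x).2) := by
  have h2 : (2 : ℚ) ≠ 0 := by norm_num
  obtain ⟨⟨p, q, e⟩, k, k'⟩ := x
  obtain ⟨n, n'⟩ := n
  cases s <;> simp [semN, num1, sg, zpow_sub₀ h2] <;> field_simp <;> ring

theorem sem_num3 (s : Bool) (x : CN) (n : ℕ × ℕ) :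
    semN (num3 s x n) = (Int.fract (w3 (sg s) (semN x) ((n.1 : ℤ) - n.2)), (semN x).2 + sg s) ∧
    ((car3 s x n).1 : ℤ) - (car3 s x n).2 = ⌊w3 (sg s) (semN x) ((n.1 : ℤ) - n.2)⌋ := by
  have pos : ∀ m : ℕ, 1 ≤ 2 ^ m := fun m => Nat.one_le_two_pow
  have key : w3 (sg s) (semN x) ((n.1 : ℤ) - n.2) =
      ((tot3 s x n % 2 ^ exp3 s x : ℕ) : ℚ) / 2 ^ exp3 s x +
        ((((car3 s x n).1 : ℤ) - (car3 s x n).2 : ℤ) : ℚ) := by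
    have hd : ((tot3 s x n % 2 ^ exp3 s x : ℕ) : ℚ) +
        2 ^ exp3 s x * ((tot3 s x n / 2 ^ exp3 s x : ℕ) : ℚ) = (tot3 s x n : ℕ) := by
      exact_mod_cast Nat.mod_add_div (tot3 s x n) (2 ^ exp3 s x)
    have hd' : ((tot3 s x n % 2 ^ exp3 s x : ℕ) : ℚ) = (tot3 s x n : ℕ) -
        2 ^ exp3 s x * ((tot3 s x n / 2 ^ exp3 s x : ℕ) : ℚ) := by linarith
    rw [hd']
    obtain ⟨⟨p, q, e⟩, k, k'⟩ := x
    obtain ⟨n, n'⟩ := n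
    cases s with
    | true =>
      have hT' : ((tot3 true ((p, q, e), k, k') (n, n') : ℕ) : ℚ) =
          p + 2 ^ e * n + 2 ^ e * n' + q * (2 ^ (e + 1) - 1) := by
        simp only [tot3, cond_true]; push_cast [pos (e + 1)]; ring
      simp only [hT', car3, exp3, w3, semN, sg, cond_true]
      generalize tot3 true ((p, q, e), k, k') (n, n') / 2 ^ (e + 1) = D
      push_cast
      rw [zpow_neg, zpow_one]
      field_simp
      ring
    | false =>
      have hT' : ((tot3 false ((p, q, e), k, k') (n, n') : ℕ) : ℚ) =
          2 * p + 2 * q * (2 ^ e - 1) := by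
        simp only [tot3, cond_false]; push_cast [pos e]; ring
      simp only [hT', car3, exp3, w3, semN, sg, cond_false]
      generalize tot3 false ((p, q, e), k, k') (n, n') / 2 ^ e = D
      push_cast
      field_simp
      ring
  have hpos : (0 : ℚ) < 2 ^ exp3 s x := by positivity
  have h0 : (0 : ℚ) ≤ ((tot3 s x n % 2 ^ exp3 s x : ℕ) : ℚ) / 2 ^ exp3 s x := by positivity
  have hlt : ((tot3 s x n % 2 ^ exp3 s x : ℕ) : ℚ) / 2 ^ exp3 s x < 1 := by
    rw [div_lt_one hpos]
    exact_mod_cast Nat.mod_lt _ (pos (exp3 s x))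
  have hf := Int.fract_eq_self.2 ⟨h0, hlt⟩
  have hfl := Int.floor_eq_zero_iff.2 ⟨h0, hlt⟩
  rw [key, Int.fract_add_intCast, Int.floor_add_intCast, hf, hfl]
  refine ⟨?_, by ring⟩
  cases s <;> simp [semN, num3, sg] <;> ring

theorem sem_step (c : CC) (x : Fin 3 × Bool) : sem (cstep c x) = sstep (sem c) x := by
  obtain ⟨i, s⟩ := x
  obtain ⟨l, n⟩ := c
  unfold cstep sstep
  simp only
  split_ifs
  · simp only [sem, cR1, sR1, sem_push, sem_pop, sem_num1]
  · cases s <;> simp [sem, cR2, sR2, sg] <;> ring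
  · obtain ⟨ha, hb⟩ := sem_num3 s (cpop false l).1 n
    simp only [sem, cR3, sR3, sem_push, sem_pop, ha, hb]

theorem sem_run (u : W3) : sem (crun u) = ((wval gA u).unop x0 : X) := by
  rw [gA_run]
  have : ∀ (u : W3) (c : CC), sem (u.foldl cstep c) = u.foldl sstep (sem c) := by
    intro u
    induction u with
    | nil => intro c; rfl
    | cons x u ih => intro c; rw [List.foldl_cons, ih, sem_step]; rfl
  rw [crun, this]
  rfl

/-! ### The free subgroup -/

def sletS (a : SL) : Prop := bif a.1 then Int.fract a.2.1 = 0 else a.2.1 = 0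

def sS (c : SS) : Prop := (∀ a ∈ c.1, sletS a) ∧ c.2 = 0

theorem sem_letS (a : CL) : sletS (a.1, semN a.2) ↔ letS a := by
  obtain ⟨b, ⟨p, q, e⟩, k, k'⟩ := a
  have hpos : (0 : ℚ) < 2 ^ e := by positivity
  cases b with
  | true =>
    simp only [sletS, letS, semN, cond_true, true_and, Bool.true_eq_false, false_and, or_false]
    rw [Int.fract_eq_zero_iff, ← Nat.ModEq, Nat.modEq_iff_dvd]
    constructor
    · rintro ⟨m, hm⟩
      rw [eq_div_iff hpos.ne'] at hm
      refine ⟨-m, ?_⟩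
      have : (m : ℤ) * 2 ^ e = (p : ℤ) - q := by exact_mod_cast hm
      push_cast
      linarith
    · rintro ⟨m, hm⟩
      refine ⟨-m, ?_⟩
      rw [eq_div_iff hpos.ne']
      have : (-m : ℤ) * 2 ^ e = (p : ℤ) - q := by push_cast at hm; linarith
      exact_mod_cast this
  | false =>
    simp only [sletS, letS, semN, cond_false, true_and, Bool.false_eq_true, false_and, false_or]
    rw [div_eq_zero_iff, sub_eq_zero]
    simp

theorem sem_S (c : CC) : sS (sem c) ↔ cS c := by
  simp only [sS, cS, sem, semL, List.forall_mem_map, sem_letS]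
  rw [sub_eq_zero]; simp

theorem sem_triv (c : CC) : sem c = x0.1 ↔ isTriv c := by
  simp only [sem, isTriv, x0, Prod.ext_iff, semL, List.map_eq_nil_iff, sub_eq_zero]
  simp

abbrev F2 := FreeGroup Bool

def fL (a : SL) : F2 :=
  bif a.1 then FreeGroup.of true ^ ⌊a.2.1⌋ else FreeGroup.of false ^ a.2.2

def fE : List SL → F2
  | [] => 1
  | a :: l => fE l * fL a

theorem fE_push (b : Bool) (x : SN) (l : List SL) : fE (spush b x l) = fE l * fL (b, x) := by
  unfold spush
  split_ifs with h
  · subst h; cases b <;> simp [fL]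
  · rfl

theorem fE_pop (b : Bool) (l : List SL) : fE (spop b l).2 * fL (b, (spop b l).1) = fE l := by
  have hz : fL (b, (0 : SN)) = 1 := by cases b <;> simp [fL]
  cases l with
  | nil => simp [spop, hz]
  | cons a r =>
    unfold spop
    by_cases h : a.1 = b
    · subst h; simp [fE]
    · simp [h, hz]

theorem sS_push (b : Bool) (x : SN) (l : List SL) (h : ∀ a ∈ l, sletS a) (hx : sletS (b, x)) :
    ∀ a ∈ spush b x l, sletS a := by
  unfold spush
  split_ifs
  · exact h
  · simpa [hx] using h

theorem sS_pop (b : Bool) (l : List SL) (h : ∀ a ∈ l, sletS a) :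
    (∀ a ∈ (spop b l).2, sletS a) ∧ sletS (b, (spop b l).1) := by
  have hz : sletS (b, (0 : SN)) := by cases b <;> simp [sletS]
  cases l with
  | nil => simp [spop, hz]
  | cons a r =>
    unfold spop
    by_cases hb : a.1 = b
    · subst hb
      simp only [if_true]
      exact ⟨fun x hx => h x (List.mem_cons_of_mem _ hx), h a List.mem_cons_self⟩
    · simp only [hb, if_false]; exact ⟨h, hz⟩

theorem sS_R1 (ε : ℤ) (c : SS) (h : sS c) :
    sS (sR1 ε c) ∧ fE (sR1 ε c).1 = fE c.1 * FreeGroup.of true ^ ε := by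
  obtain ⟨l, n⟩ := c
  obtain ⟨hl, hn⟩ := h
  simp only at hl hn
  subst hn
  obtain ⟨ha, hb⟩ := sS_pop true l hl
  refine ⟨⟨sS_push _ _ _ ha ?_, rfl⟩, ?_⟩
  · simpa [sletS] using hb
  · simp only [sR1, fE_push]
    rw [← fE_pop true l]
    simp [fL, zpow_add, mul_assoc]

theorem sS_R3 (ε : ℤ) (c : SS) (h : sS c) :
    sS (sR3 ε c) ∧ fE (sR3 ε c).1 = fE c.1 * FreeGroup.of false ^ ε := by
  obtain ⟨l, n⟩ := c
  obtain ⟨hl, hn⟩ := h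
  simp only at hl hn
  subst hn
  obtain ⟨ha, hb⟩ := sS_pop false l hl
  have hw : w3 ε (spop false l).1 0 = 0 := by
    simp only [sletS, cond_false] at hb
    simp [w3, hb]
  refine ⟨⟨sS_push _ _ _ ha ?_, ?_⟩, ?_⟩
  · simp [sletS, hw]
  · simp [sR3, hw]
  · simp only [sR3, fE_push]
    rw [← fE_pop false l]
    simp [fL, zpow_add, mul_assoc]

/-- the free group of rank two in the group of permutations, `t` selects the frame -/
def phi (t : Bool) : F2 →* GG :=
  FreeGroup.lift fun b => if b = t then gA 0 else gA 2

theorem phi_act (v : F2) : ∀ c : X, sS c.1 → sS ((phi true v).unop c : X).1 ∧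
    fE ((phi true v).unop c : X).1.1 = fE c.1.1 * v := by
  have et : phi true (FreeGroup.of true) = gA 0 := by simp [phi]
  have ef : phi true (FreeGroup.of false) = gA 2 := by simp [phi]
  induction v using FreeGroup.induction_on with
  | C1 => intro c hc; simpa using hc
  | of b =>
    intro c hc
    cases b with
    | true =>
      have h := sS_R1 1 c.1 hc
      rw [zpow_one] at h
      rw [et]; exact h
    | false =>
      have h := sS_R3 1 c.1 hc
      rw [zpow_one] at h
      rw [ef]; exact h
  | inv_of b ih =>
    intro c hc
    cases b with
    | true =>
      have h := sS_R1 (-1) c.1 hc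
      rw [zpow_neg_one] at h
      rw [map_inv, et]; exact h
    | false =>
      have h := sS_R3 (-1) c.1 hc
      rw [zpow_neg_one] at h
      rw [map_inv, ef]; exact h
  | mul v w ihv ihw =>
    intro c hc
    obtain ⟨a, b⟩ := ihv c hc
    obtain ⟨a', b'⟩ := ihw _ a
    simp only [map_mul, MulOpposite.unop_mul, Equiv.Perm.mul_apply]
    exact ⟨a', by rw [b', b, mul_assoc]⟩


/-! ### The amalgam -/

theorem phi_inj_true : Function.Injective (phi true) := by
  rw [injective_iff_map_eq_one]
  intro v hv
  have h := (phi_act v x0 ⟨by simp [x0], rfl⟩).2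
  rw [hv] at h
  change (1 : F2) = 1 * v at h
  rw [one_mul] at h
  exact h.symm

theorem phi_false (v : F2) : phi false v = phi true (FreeGroup.map not v) := by
  have : phi false = (phi true).comp (FreeGroup.map not) := by
    ext b
    cases b <;> simp [phi]
  rw [this]; rfl

theorem phi_inj (t : Bool) : Function.Injective (phi t) := by
  cases t with
  | true => exact phi_inj_true
  | false =>
    intro v w h
    rw [phi_false, phi_false] at h
    exact FreeGroup.map_injective Bool.not_injective (phi_inj_true h)

theorem gA_ends (t : Bool) : gA 0 = phi t (FreeGroup.of t) ∧ gA 2 = phi t (FreeGroup.of (!t)) := by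
  cases t <;> simp [phi]

theorem mem_range_S (t : Bool) (u : W3) (h : wval gA u ∈ (phi t).range) : cS (crun u) := by
  have : wval gA u ∈ (phi true).range := by
    cases t with
    | true => exact h
    | false =>
      obtain ⟨v, hv⟩ := h
      exact ⟨_, (phi_false v).symm.trans hv⟩
  obtain ⟨v, hv⟩ := this
  have h2 := (phi_act v x0 ⟨by simp [x0], rfl⟩).1
  rw [hv, ← sem_run, sem_S] at h2
  exact h2

theorem cW_letters (c : CC) : ∀ x ∈ cW c, x.1 = 0 ∨ x.1 = 2 := by
  intro x hx
  simp only [cW, List.mem_flatMap] at hx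
  obtain ⟨⟨b, y⟩, -, hx⟩ := hx
  cases b <;> simp [letW, rep] at hx <;> aesop

theorem wval_cW_congr {Γ : Type*} [Group Γ] (g h : Fin 3 → Γ) (h0 : g 0 = h 0) (h2 : g 2 = h 2)
    (c : CC) : wval g (cW c) = wval h (cW c) := by
  unfold wval
  congr 1
  apply List.map_congr_left
  intro x hx
  rcases cW_letters c x hx with e | e <;> simp only [e, h0, h2]

theorem S_mem_range (t : Bool) (u : W3) (h : cS (crun u)) : wval gA u ∈ (phi t).range := by
  rw [← ev_run gA_rel1 gA_rel2 u, ← wval_cW gA_rel1 _ h]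
  unfold wval
  apply Subgroup.list_prod_mem
  intro y hy
  rw [List.mem_map] at hy
  obtain ⟨x, hx, rfl⟩ := hy
  apply Subgroup.zpow_mem
  obtain ⟨e0, e2⟩ := gA_ends t
  rcases cW_letters _ x hx with e | e
  · rw [e]; exact ⟨_, e2.symm⟩
  · rw [e]; exact ⟨_, e0.symm⟩

abbrev PP := Monoid.PushoutI (ι := Bool) (G := fun _ => GG) (H := F2) phi

abbrev po (t : Bool) : GG →* PP := Monoid.PushoutI.of (φ := phi) t

theorem po_02 (t : Bool) : po t (gA 0) = po (!t) (gA 2) := by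
  rw [(gA_ends t).1, (gA_ends (!t)).2, Bool.not_not]
  exact (Monoid.PushoutI.of_apply_eq_base phi t _).trans
    (Monoid.PushoutI.of_apply_eq_base phi (!t) _).symm

def genP : ZMod 4 → PP :=
  (![po false (gA 1), po true (gA 0), po true (gA 1), po true (gA 2)] : Fin 4 → PP)

theorem po_rel1 (t : Bool) : po t (gA 1) * po t (gA 0) * (po t (gA 1))⁻¹ = po t (gA 0) ^ 2 := by
  rw [← map_inv, ← map_mul, ← map_mul, gA_rel1, map_pow]

theorem po_rel2 (t : Bool) : po t (gA 2) * po t (gA 1) * (po t (gA 2))⁻¹ = po t (gA 1) ^ 2 := by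
  rw [← map_inv, ← map_mul, ← map_mul, gA_rel2, map_pow]

theorem genP_rel (p : ZMod 4) :
    genP p * genP (p - 1) * (genP p)⁻¹ = genP (p - 1) ^ 2 := by
  have a := po_rel1 true
  have b := po_rel2 true
  have c := po_rel1 false
  have d := po_rel2 false
  rw [po_02 false] at c
  rw [← Bool.not_true, ← po_02 true] at d
  revert p
  intro p
  fin_cases p
  · exact c
  · exact d
  · exact a
  · exact b

def Phi : Higman 4 →* PP := PresentedGroup.toGroup (f := genP) (by
  rintro r ⟨p, rfl⟩
  have := genP_rel p
  simp only [map_mul, map_inv, FreeGroup.lift_apply_of]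
  rw [this, pow_two, mul_inv_cancel])

theorem Phi_gen (p : ZMod 4) : Phi (hgen 4 p) = genP p := PresentedGroup.toGroup.of _

/-! ### Frames in the Higman group -/

def hg (t : Bool) : Fin 3 → Higman 4 :=
  bif t then ![hgen 4 1, hgen 4 2, hgen 4 3] else ![hgen 4 3, hgen 4 0, hgen 4 1]

theorem hgen_rel (p : ZMod 4) : hgen 4 p * hgen 4 (p - 1) * (hgen 4 p)⁻¹ = hgen 4 (p - 1) ^ 2 := by
  have h : PresentedGroup.mk (higmanRels 4) (FreeGroup.of p * FreeGroup.of (p - 1) *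
      (FreeGroup.of p)⁻¹ * (FreeGroup.of (p - 1) * FreeGroup.of (p - 1))⁻¹) = 1 :=
    PresentedGroup.one_of_mem ⟨p, rfl⟩
  rw [map_mul, map_inv, mul_inv_eq_one] at h
  rw [pow_two]
  exact h

theorem hg_rel1 (t : Bool) : hg t 1 * hg t 0 * (hg t 1)⁻¹ = hg t 0 ^ 2 := by
  cases t
  · exact hgen_rel 0
  · exact hgen_rel 2

theorem hg_rel2 (t : Bool) : hg t 2 * hg t 1 * (hg t 2)⁻¹ = hg t 1 ^ 2 := by
  cases t
  · exact hgen_rel 1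
  · exact hgen_rel 3

theorem hg_sw (t : Bool) : hg (!t) 0 = sw (hg t) 0 ∧ hg (!t) 2 = sw (hg t) 2 := by
  cases t <;> exact ⟨rfl, rfl⟩

theorem wval_hg_cW (t : Bool) (u : W3) (h : cS (crun u)) :
    wval (hg (!t)) (cW (crun u)) = wval (hg t) u := by
  rw [wval_cW_congr _ _ (hg_sw t).1 (hg_sw t).2, wval_cW (hg_rel1 t) _ h,
    ev_run (hg_rel1 t) (hg_rel2 t)]

theorem Phi_hg (t : Bool) (j : Fin 3) : Phi (hg t j) = po t (gA j) := by
  have e := po_02 false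
  have e' := po_02 true
  cases t <;> fin_cases j
  · exact (Phi_gen 3).trans e.symm
  · exact Phi_gen 0
  · exact (Phi_gen 1).trans e'
  · exact Phi_gen 1
  · exact Phi_gen 2
  · exact Phi_gen 3

theorem Phi_wval (t : Bool) (u : W3) : Phi (wval (hg t) u) = po t (wval gA u) := by
  unfold wval
  rw [map_list_prod, map_list_prod, List.map_map, List.map_map]
  congr 1
  apply List.map_congr_left
  intro x _
  simp only [Function.comp, map_zpow, Phi_hg]

/-! ### The invariant of the algorithm -/

def rVal : Bool → List W3 → Higman 4
  | _, [] => 1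
  | t, d :: r => wval (hg t) d * rVal (!t) r

def letV (x : Fin 4 × Bool) : Higman 4 := hgen 4 (((x.1 : ℕ) : ZMod 4) + 1) ^ sg x.2

theorem frame_some (t : Bool) (i : Fin 4) (j : Fin 3) (h : frame t i = some j) :
    hgen 4 (((i : ℕ) : ZMod 4) + 1) = hg t j := by
  cases t <;> fin_cases i <;> simp [frame] at h <;> subst h <;> rfl

theorem frame_none (t : Bool) (i : Fin 4) (h : frame t i = none) :
    hgen 4 (((i : ℕ) : ZMod 4) + 1) = hg (!t) 1 := by
  cases t <;> fin_cases i <;> simp [frame] at h <;> rfl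

theorem wval_cons {Γ : Type*} [Group Γ] (g : Fin 3 → Γ) (x : Fin 3 × Bool) (u : W3) :
    wval g (x :: u) = g x.1 ^ sg x.2 * wval g u := by
  simp [wval]

theorem rVal_head (t : Bool) (r : List W3) : wval (hg t) r.headI * rVal (!t) r.tail = rVal t r := by
  cases r with
  | nil => exact mul_one (1 : Higman 4)
  | cons d r => rfl

theorem hstep_val (x : Fin 4 × Bool) (s : ST) :
    rVal (hstep x s).1.1 ((hstep x s).1.2 :: (hstep x s).2) =
      letV x * rVal s.1.1 (s.1.2 :: s.2) := by
  obtain ⟨⟨t, u⟩, r⟩ := s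
  unfold hstep letV
  simp only
  cases hf : frame t x.1 with
  | some j =>
    simp only [rVal, wval_cons, frame_some _ _ _ hf, mul_assoc]
  | none =>
    simp only
    rw [frame_none _ _ hf]
    split_ifs with h
    · simp only [rVal, wval_cons, wval_append, wval_hg_cW _ _ h, mul_assoc]
      rw [rVal_head (!t) r]
    · simp only [rVal, wval_cons, mul_assoc, Bool.not_not]
      simp [wval]

theorem hstep_red (x : Fin 4 × Bool) (s : ST) (h : ∀ d ∈ s.2, ¬ cS (crun d)) :
    ∀ d ∈ (hstep x s).2, ¬ cS (crun d) := by
  obtain ⟨⟨t, u⟩, r⟩ := s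
  unfold hstep
  simp only
  cases hf : frame t x.1 with
  | some j => exact h
  | none =>
    simp only
    split_ifs with hS
    · exact fun d hd => h d (List.mem_of_mem_tail hd)
    · intro d hd
      rcases List.mem_cons.1 hd with rfl | hd
      · exact hS
      · exact h d hd

theorem hrun_inv (w : List (Fin 4 × Bool)) :
    rVal (hrun w).1.1 ((hrun w).1.2 :: (hrun w).2) = higmanEvalWord w ∧
      ∀ d ∈ (hrun w).2, ¬ cS (crun d) := by
  induction w with
  | nil => exact ⟨by simp [hrun, rVal, wval, higmanEvalWord], by simp [hrun]⟩
  | cons x w ih =>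
    have e : hrun (x :: w) = hstep x (hrun w) := rfl
    rw [e]
    refine ⟨?_, hstep_red x _ ih.2⟩
    rw [hstep_val, ih.1]
    obtain ⟨i, s⟩ := x
    cases s <;> simp [higmanEvalWord, letV, sg]

def sigs : Bool → List W3 → List (Σ _ : Bool, GG)
  | _, [] => []
  | t, d :: r => ⟨t, wval gA d⟩ :: sigs (!t) r

theorem sigs_chain (t : Bool) (r : List W3) :
    (sigs t r).IsChain (fun l l' => l.1 ≠ l'.1) := by
  induction r generalizing t with
  | nil => exact List.isChain_nil
  | cons d r ih =>
    cases r with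
    | nil => exact List.isChain_singleton _
    | cons d' r => exact List.isChain_cons_cons.2 ⟨by cases t <;> simp, ih (!t)⟩

theorem sigs_red (t : Bool) (r : List W3) (h : ∀ d ∈ r, ¬ cS (crun d)) :
    ∀ g ∈ sigs t r, g.2 ∉ (phi g.1).range := by
  induction r generalizing t with
  | nil => simp [sigs]
  | cons d r ih =>
    intro g hg
    rcases List.mem_cons.1 hg with rfl | hg
    · exact fun hm => h d List.mem_cons_self (mem_range_S _ _ hm)
    · exact ih _ (fun d hd => h d (List.mem_cons_of_mem _ hd)) g hg

theorem Phi_rVal (t : Bool) (r : List W3) :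
    Phi (rVal t r) = ((sigs t r).map fun g => po g.1 g.2).prod := by
  induction r generalizing t with
  | nil => simp [rVal, sigs]
  | cons d r ih => simp only [rVal, sigs, map_mul, List.map_cons, List.prod_cons, ih, Phi_wval]

theorem rVal_not_base (t : Bool) (r : List W3) (h : ∀ d ∈ r, ¬ cS (crun d))
    (hb : Phi (rVal t r) ∈ (Monoid.PushoutI.base phi).range) : r = [] := by
  have hr := sigs_red t r h
  let w : Monoid.CoprodI.Word (fun _ : Bool => GG) :=
    { toList := sigs t r
      ne_one := fun g hg h1 => hr g hg (h1 ▸ one_mem _)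
      chain_ne := sigs_chain t r }
  have hw : Monoid.PushoutI.Reduced phi w := hr
  have he := hw.eq_empty_of_mem_range phi_inj (by
    rw [Phi_rVal] at hb
    have : Monoid.PushoutI.ofCoprodI (φ := phi) w.prod =
        ((sigs t r).map fun g => po g.1 g.2).prod := by
      unfold Monoid.CoprodI.Word.prod
      rw [map_list_prod, List.map_map]
      congr 1
    rw [this]; exact hb)
  have : sigs t r = [] := congrArg Monoid.CoprodI.Word.toList he
  cases r with
  | nil => rfl
  | cons d r => simp [sigs] at this

theorem wval_one_of_triv {Γ : Type*} [Group Γ] (g : Fin 3 → Γ)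
    (h1 : g 1 * g 0 * (g 1)⁻¹ = g 0 ^ 2) (h2 : g 2 * g 1 * (g 2)⁻¹ = g 1 ^ 2)
    (u : W3) (h : isTriv (crun u)) : wval g u = 1 := by
  rw [← ev_run h1 h2 u, evC, h.1, h.2]
  simp [evList]

theorem hdec_spec (w : List (Fin 4 × Bool)) : hdec w = true ↔ higmanEvalWord w = 1 := by
  obtain ⟨hv, hr⟩ := hrun_inv w
  rw [← hv]
  unfold hdec
  rw [decide_eq_true_iff]
  generalize hrun w = s at *
  obtain ⟨⟨t, u⟩, r⟩ := s
  simp only at *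
  constructor
  · rintro ⟨rfl, h⟩
    simp [rVal, wval_one_of_triv _ (hg_rel1 t) (hg_rel2 t) u h]
  · intro h
    by_cases hS : cS (crun u)
    · have hbase : Phi (rVal (!t) r) ∈ (Monoid.PushoutI.base phi).range := by
        obtain ⟨v, hv⟩ := S_mem_range t u hS
        have h' := congrArg Phi h
        rw [rVal, map_mul, Phi_wval, ← hv, map_one] at h'
        have e : po t (phi t v) = Monoid.PushoutI.base phi v :=
          Monoid.PushoutI.of_apply_eq_base phi t v
        rw [e] at h'
        exact ⟨v⁻¹, by rw [map_inv]; exact inv_eq_of_mul_eq_one_right h'⟩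
      have hr0 := rVal_not_base _ _ hr hbase
      refine ⟨hr0, ?_⟩
      subst hr0
      have h' := congrArg Phi h
      rw [rVal, rVal, mul_one, Phi_wval, map_one, ← map_one (po t)] at h'
      have h1 : wval gA u = 1 := Monoid.PushoutI.of_injective phi_inj t h'
      rw [← sem_triv, sem_run, h1]
      rfl
    · have := rVal_not_base t (u :: r) (by
        intro d hd
        rcases List.mem_cons.1 hd with rfl | hd
        · exact hS
        · exact hr d hd) (by rw [h, map_one]; exact one_mem _)
      simp at this

end HG

/-- The word problem of the Higman group H₄ is decidable: there is a
computable function deciding whether a word over the generators and their inverses represents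
the identity. -/
theorem higman4_word_problem_decidable :
    ∃ f : List (Fin 4 × Bool) → Bool, Computable f ∧
      ∀ w : List (Fin 4 × Bool), f w = true ↔ higmanEvalWord w = 1 := by
  exact ⟨HG.hdec, HG.pr_hdec.to_comp, HG.hdec_spec⟩
end
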